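/- arXiv:2105.08373 — 2 statements merged into one kernel-verified Lean document; each statement's English description precedes it below -/
import Mathlib

section
/- Let (𝒳₀,𝒳₁) be a compatible couple of sequentially structured Banach spaces with 𝔖₀ and 𝔖₁ both ℓ∞-sequence structures, and let θ ∈ (0,1). Then (𝒳₀,𝒳₁)_θ^∘ = (𝒳₀^∘,𝒳₁^∘)_θ with equivalent norms. If moreover 𝔖₀ or 𝔖₁ is a c₀-sequence structure, then (𝒳₀,𝒳₁)_θ = (𝒳₀^∘,𝒳₁^∘)_θ with equivalent norms. -/
open scoped ENNReal NNReal
open Filter Topology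

universe u v

/-- The axioms of a complete ("Banach") extended norm on a module over a normed field:
definiteness, the triangle inequality, homogeneity, and completeness of the finiteness
domain.  A Banach space continuously embedded into an ambient space `E` is encoded as such
an extended norm on `E`; the Banach space itself is the finiteness domain. -/
def IsBanachENorm (𝕜 : Type*) {E : Type*} [NormedField 𝕜] [AddCommGroup E] [Module 𝕜 E]
    (N : E → ℝ≥0∞) : Prop :=
  (∀ x : E, N x = 0 → x = 0) ∧
  (∀ x y : E, N (x + y) ≤ N x + N y) ∧
  (∀ (c : 𝕜) (x : E), N (c • x) ≤ (‖c‖₊ : ℝ≥0∞) * N x) ∧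
  (∀ f : ℕ → E, (∀ n, N (f n) ≠ ∞) →
    (∀ ε : ℝ≥0∞, 0 < ε → ∃ n₀ : ℕ, ∀ m, n₀ ≤ m → ∀ n, n₀ ≤ n → N (f m - f n) < ε) →
    ∃ x : E, N x ≠ ∞ ∧ Filter.Tendsto (fun n => N (f n - x)) Filter.atTop (nhds 0))

/-- A Banach space continuously embedded into the ambient space `E`, encoded as a complete
extended norm on `E`. -/
structure BanachENorm (𝕜 : Type*) (E : Type*) [NormedField 𝕜] [AddCommGroup E]
    [Module 𝕜 E] where
  toFun : E → ℝ≥0∞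
  isBanachENorm : IsBanachENorm 𝕜 toFun

/-- A sequence structure `𝔖` on the Banach space `X`: a Banach space of `X`-valued sequences
which is translation invariant, contains the single-entry sequences isometrically, and has
contractive coordinate projections. -/
structure SeqStructure (𝕜 : Type*) (E : Type*) [NormedField 𝕜] [AddCommGroup E] [Module 𝕜 E]
    (X : BanachENorm 𝕜 E) where
  toFun : (ℤ → E) → ℝ≥0∞
  isBanachENorm : IsBanachENorm 𝕜 toFun
  single : ∀ (v : E) (n : ℤ), toFun (fun k => if k = n then v else 0) = X.toFun v
  shift : ∀ (x : ℤ → E) (n : ℤ), toFun (fun k => x (k + n)) = toFun x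
  coord : ∀ (x : ℤ → E) (n : ℤ), X.toFun (x n) ≤ toFun x

/-- The `n`-th Cesàro mean `C_n x⃗ = (n+1)⁻¹ ∑_{m=0}^{n} x⃗⁽ᵐ⁾`, where `x⃗⁽ᵐ⁾` is the
truncation of `x⃗` to the indices `|k| ≤ m`. -/
noncomputable def cesaro (𝕜 : Type*) {E : Type*} [NormedField 𝕜] [AddCommGroup E]
    [Module 𝕜 E] (n : ℕ) (x : ℤ → E) : ℤ → E :=
  fun k => (n + 1 : 𝕜)⁻¹ • ∑ m ∈ Finset.range (n + 1), (if |k| ≤ (m : ℤ) then x k else 0)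

/-- An `ℓ∞`-sequence structure: the Cesàro operators are contractive. -/
def IsLinftySeqStructure {𝕜 E : Type*} [NormedField 𝕜] [AddCommGroup E] [Module 𝕜 E]
    {X : BanachENorm 𝕜 E} (S : SeqStructure 𝕜 E X) : Prop :=
  ∀ (n : ℕ) (x : ℤ → E), S.toFun (cesaro 𝕜 n x) ≤ S.toFun x

/-- A `c₀`-sequence structure: the Cesàro operators are contractive and `C_n x⃗ → x⃗` in `𝔖`
for every `x⃗ ∈ 𝔖`. -/
def IsC0SeqStructure {𝕜 E : Type*} [NormedField 𝕜] [AddCommGroup E] [Module 𝕜 E]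
    {X : BanachENorm 𝕜 E} (S : SeqStructure 𝕜 E X) : Prop :=
  IsLinftySeqStructure S ∧
    ∀ x : ℤ → E, S.toFun x ≠ ∞ →
      Filter.Tendsto (fun n => S.toFun (cesaro 𝕜 n x - x)) Filter.atTop (nhds 0)

/-- The extended norm of the sum of two extended-normed spaces. -/
noncomputable def enSum {V : Type*} [AddCommGroup V] (N M : V → ℝ≥0∞) : V → ℝ≥0∞ :=
  fun v => ⨅ w : V, N w + M (v - w)

/-- The extended norm of the intersection of two extended-normed spaces. -/
def enInter {V : Type*} (N M : V → ℝ≥0∞) : V → ℝ≥0∞ := fun v => max (N v) (M v)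

/-- The weighted sequence space `𝔖(a)`, `‖x⃗‖_{𝔖(a)} = ‖(a^k x_k)_k‖_𝔖`. -/
noncomputable def wtSeq {E : Type*} [AddCommGroup E] [Module ℝ E] (a : ℝ)
    (S : (ℤ → E) → ℝ≥0∞) : (ℤ → E) → ℝ≥0∞ :=
  fun x => S fun k => (a ^ k) • x k

/-- The sequentially structured interpolation extended norm with base number `b`:
`‖v‖_{(𝒳₀,𝒳₁)_{θ;b}} = inf { max_{j=0,1} ‖(b^{k(j-θ)} x_k)_k‖_{𝔖_j} : ∑_k x_k = v }`,
the sum converging in the sum space `X₀ + X₁` (the ambient space `E`). -/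
noncomputable def interpENormB {E : Type*} [NormedAddCommGroup E] [NormedSpace ℝ E] (b : ℝ)
    (S₀ S₁ : (ℤ → E) → ℝ≥0∞) (θ : ℝ) (v : E) : ℝ≥0∞ :=
  ⨅ (x : ℤ → E) (_ : HasSum x v),
    max (wtSeq (b ^ (-θ)) S₀ x) (wtSeq (b ^ (1 - θ)) S₁ x)

/-- The sequentially structured interpolation extended norm (base number `e`). -/
noncomputable def interpENorm {E : Type*} [NormedAddCommGroup E] [NormedSpace ℝ E]
    (S₀ S₁ : (ℤ → E) → ℝ≥0∞) (θ : ℝ) (v : E) : ℝ≥0∞ :=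
  ⨅ (x : ℤ → E) (_ : HasSum x v),
    max (wtSeq (Real.exp (-θ)) S₀ x) (wtSeq (Real.exp (1 - θ)) S₁ x)

/-- The mean-method formulation of the interpolation norm. -/
noncomputable def meanENorm {E : Type*} [AddCommGroup E] [Module ℝ E]
    (S₀ S₁ : (ℤ → E) → ℝ≥0∞) (θ : ℝ) (v : E) : ℝ≥0∞ :=
  ⨅ (x0 : ℤ → E) (x1 : ℤ → E) (_ : ∀ k : ℤ, x0 k + x1 k = v),
    wtSeq (Real.exp (-θ)) S₀ x0 + wtSeq (Real.exp (1 - θ)) S₁ x1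

/-- The dual extended norm on linear functionals. -/
noncomputable def dualENorm {E : Type*} [AddCommGroup E] [Module ℝ E] (N : E → ℝ≥0∞)
    (φ : E →ₗ[ℝ] ℝ) : ℝ≥0∞ :=
  ⨆ (x : E) (_ : N x ≤ 1), (‖φ x‖₊ : ℝ≥0∞)

/-- The dual sequence norm, via the pairing `⟨x⃗, x⃗*⟩ = ∑_k ⟨x_k, x*_k⟩`. -/
noncomputable def dualSeqENorm {E : Type*} [AddCommGroup E] [Module ℝ E]
    (S : (ℤ → E) → ℝ≥0∞) (Φ : ℤ → E →ₗ[ℝ] ℝ) : ℝ≥0∞ :=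
  ⨆ (x : ℤ → E) (_ : (Function.support x).Finite) (_ : S x ≤ 1),
    (‖∑ᶠ k : ℤ, Φ k (x k)‖₊ : ℝ≥0∞)

/-- The interpolation norm of the dual couple `(𝒳₀*,𝒳₁*)_θ`
(in its mean-method formulation). -/
noncomputable def dualInterpMean {E : Type*} [AddCommGroup E] [Module ℝ E]
    (S₀ S₁ : (ℤ → E) → ℝ≥0∞) (θ : ℝ) (φ : E →ₗ[ℝ] ℝ) : ℝ≥0∞ :=
  ⨅ (Φ₀ : ℤ → E →ₗ[ℝ] ℝ) (Φ₁ : ℤ → E →ₗ[ℝ] ℝ) (_ : ∀ k : ℤ, Φ₀ k + Φ₁ k = φ),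
    wtSeq (Real.exp (-θ)) (dualSeqENorm S₀) Φ₀ +
      wtSeq (Real.exp (1 - θ)) (dualSeqENorm S₁) Φ₁

/-- Membership in the closure, inside the space with extended norm `Nj`, of the space with
extended norm `N`. -/
def memClosIn {E : Type*} [AddCommGroup E] (Nj N : E → ℝ≥0∞) (w : E) : Prop :=
  Nj w ≠ ∞ ∧ ∀ ε : ℝ≥0∞, 0 < ε → ∃ u : E, N u ≠ ∞ ∧ Nj (w - u) < ε

open Classical in
/-- The extended norm of the closure, inside the space with extended norm `Nj`, of the
space with extended norm `N`. -/
noncomputable def closENorm {E : Type*} [AddCommGroup E] (Nj N : E → ℝ≥0∞) : E → ℝ≥0∞ :=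
  fun w => if memClosIn Nj N w then Nj w else ∞

/-- Membership in `𝔖^∘`, the closure in `𝔖` of the finitely nonzero sequences with entries
in the closure of the `N`-space inside the `Nj`-space. -/
def memSeqClos {E : Type*} [AddCommGroup E] (S : (ℤ → E) → ℝ≥0∞) (Nj N : E → ℝ≥0∞)
    (x : ℤ → E) : Prop :=
  S x ≠ ∞ ∧ ∀ ε : ℝ≥0∞, 0 < ε → ∃ y : ℤ → E,
    (Function.support y).Finite ∧ (∀ k, memClosIn Nj N (y k)) ∧ S (x - y) < ε

open Classical in
/-- The extended norm of `𝔖^∘`. -/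
noncomputable def seqClosENorm {E : Type*} [AddCommGroup E] (S : (ℤ → E) → ℝ≥0∞)
    (Nj N : E → ℝ≥0∞) : (ℤ → E) → ℝ≥0∞ :=
  fun x => if memSeqClos S Nj N x then S x else ∞

/-- The `(𝔖,𝔗)`-bound of an operator. -/
noncomputable def seqOpENorm {E F : Type*} [AddCommGroup E] [Module ℝ E]
    [AddCommGroup F] [Module ℝ F] (S : (ℤ → E) → ℝ≥0∞) (T : (ℤ → F) → ℝ≥0∞)
    (A : E →ₗ[ℝ] F) : ℝ≥0∞ :=
  ⨆ (x : ℤ → E) (_ : S x ≤ 1), T fun k => A (x k)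

/-- The open strip `𝕊 = {0 < Re z < 1}`. -/
def openStrip : Set ℂ := {z : ℂ | 0 < z.re ∧ z.re < 1}

/-- The closed strip `S̄ = {0 ≤ Re z ≤ 1}`. -/
def closedStrip : Set ℂ := {z : ℂ | 0 ≤ z.re ∧ z.re ≤ 1}

/-- The `k`-th Fourier coefficient of the `2π`-periodic function `t ↦ f (s + it)`. -/
noncomputable def fourierCoef {X : Type*} [NormedAddCommGroup X] [NormedSpace ℂ X]
    (f : ℂ → X) (s : ℝ) (k : ℤ) : X :=
  (2 * (Real.pi : ℂ))⁻¹ • ∫ t in (-Real.pi)..Real.pi,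
    Complex.exp (-(k : ℂ) * Complex.I * (t : ℂ)) • f ((s : ℂ) + (t : ℂ) * Complex.I)

/-- The lower complex formulation norm `‖·‖^{(c)}_{(𝒳₀,𝒳₁)_θ}`. -/
noncomputable def lowerCNorm {E : Type*} [NormedAddCommGroup E] [NormedSpace ℂ E]
    (S₀ S₁ : (ℤ → E) → ℝ≥0∞) (θ : ℝ) (v : E) : ℝ≥0∞ :=
  ⨅ (f : ℂ → E) (_ : ContinuousOn f closedStrip)
    (_ : ∀ z ∈ openStrip, DifferentiableAt ℂ f z)
    (_ : ∀ z ∈ closedStrip, f (z + 2 * (Real.pi : ℂ) * Complex.I) = f z)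
    (_ : f (θ : ℂ) = v),
    max (S₀ fun k => fourierCoef f 0 k) (S₁ fun k => fourierCoef f 1 k)

namespace ISS

section basic
variable {V : Type*} [AddCommGroup V] [Module ℝ V] {N : V → ℝ≥0∞}

lemma nzero (h : IsBanachENorm ℝ N) : N 0 = 0 := by
  have := h.2.2.1 0 0
  simpa using this

lemma nneg_le (h : IsBanachENorm ℝ N) (x : V) : N (-x) ≤ N x := by
  have := h.2.2.1 (-1) x
  simpa using this

lemma nneg (h : IsBanachENorm ℝ N) (x : V) : N (-x) = N x := by
  refine le_antisymm (nneg_le h x) ?_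
  simpa using nneg_le h (-x)

lemma nadd (h : IsBanachENorm ℝ N) (x y : V) : N (x + y) ≤ N x + N y := h.2.1 x y

lemma nsub (h : IsBanachENorm ℝ N) (x y : V) : N (x - y) ≤ N x + N y := by
  rw [sub_eq_add_neg]
  exact (nadd h _ _).trans (by rw [nneg h])

lemma nsub_comm (h : IsBanachENorm ℝ N) (x y : V) : N (x - y) = N (y - x) := by
  rw [← neg_sub, nneg h]

lemma nsmul (h : IsBanachENorm ℝ N) {c : ℝ} (hc : 0 ≤ c) (x : V) :
    N (c • x) ≤ ENNReal.ofReal c * N x := by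
  have := h.2.2.1 c x
  rwa [← Real.enorm_of_nonneg hc]

lemma nsum (h : IsBanachENorm ℝ N) {ι : Type*} (s : Finset ι) (f : ι → V) :
    N (∑ i ∈ s, f i) ≤ ∑ i ∈ s, N (f i) := by
  classical
  induction s using Finset.induction_on with
  | empty => simp [nzero h]
  | insert a s ha ih =>
    rw [Finset.sum_insert ha, Finset.sum_insert ha]
    exact (nadd h _ _).trans (by gcongr)

lemma nseries (h : IsBanachENorm ℝ N) (f : ℕ → V) (hf : ∑' n, N (f n) ≠ ∞) :
    ∃ x, N x ≤ ∑' n, N (f n) ∧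
      Tendsto (fun n => N (∑ i ∈ Finset.range n, f i - x)) atTop (𝓝 0) := by
  have hpart : ∀ n, N (∑ i ∈ Finset.range n, f i) ≤ ∑' n, N (f n) := fun n =>
    (nsum h _ _).trans (ENNReal.sum_le_tsum _)
  have key : ∀ n₀ m n : ℕ, n₀ ≤ m → m ≤ n →
      N (∑ i ∈ Finset.range n, f i - ∑ i ∈ Finset.range m, f i) ≤ ∑' k, N (f (k + n₀)) := by
    intro n₀ m n h0 hmn
    rw [← Finset.sum_Ico_eq_sub _ hmn]
    refine (nsum h _ _).trans ?_
    calc ∑ i ∈ Finset.Ico m n, N (f i) ≤ ∑ i ∈ Finset.Ico n₀ n, N (f i) :=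
          Finset.sum_le_sum_of_subset (Finset.Ico_subset_Ico_left h0)
      _ = ∑ i ∈ Finset.range (n - n₀), N (f (i + n₀)) := by
          rw [Finset.sum_Ico_eq_sum_range]
          simp [add_comm]
      _ ≤ _ := ENNReal.sum_le_tsum _
  have ht := ENNReal.tendsto_sum_nat_add (fun n => N (f n)) hf
  obtain ⟨x, hx, hlim⟩ := h.2.2.2 (fun n => ∑ i ∈ Finset.range n, f i)
    (fun n => ne_top_of_le_ne_top hf (hpart n)) (by
      intro ε hε
      obtain ⟨n₀, hn₀⟩ := ((ht.eventually (gt_mem_nhds hε))).exists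
      refine ⟨n₀, fun m hm n hn => ?_⟩
      rcases le_total m n with hmn | hmn
      · rw [nsub_comm h]
        exact (key n₀ m n hm hmn).trans_lt hn₀
      · exact (key n₀ n m hn hmn).trans_lt hn₀)
  refine ⟨x, ?_, hlim⟩
  have h1 : ∀ n, N x ≤ (∑' n, N (f n)) + N (∑ i ∈ Finset.range n, f i - x) := by
    intro n
    calc N x = N (∑ i ∈ Finset.range n, f i - (∑ i ∈ Finset.range n, f i - x)) := by
          rw [sub_sub_cancel]
      _ ≤ _ := (nsub h _ _).trans (by gcongr; exact hpart n)
  have h2 : Tendsto (fun n => (∑' n, N (f n)) + N (∑ i ∈ Finset.range n, f i - x)) atTop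
      (𝓝 ((∑' n, N (f n)) + 0)) := tendsto_const_nhds.add hlim
  simpa using ge_of_tendsto' h2 h1

/-- Uniqueness of limits. -/
lemma nuniq (h : IsBanachENorm ℝ N) {f : ℕ → V} {x y : V}
    (hx : Tendsto (fun n => N (f n - x)) atTop (𝓝 0))
    (hy : Tendsto (fun n => N (f n - y)) atTop (𝓝 0)) : x = y := by
  have h1 : ∀ n, N (x - y) ≤ N (f n - x) + N (f n - y) := by
    intro n
    calc N (x - y) = N ((f n - y) - (f n - x)) := by congr 1; abel
      _ ≤ _ := (nsub h _ _).trans (by rw [add_comm])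
  have h2 := ge_of_tendsto' (hx.add hy) h1
  have : N (x - y) = 0 := by simpa using h2
  exact sub_eq_zero.1 (h.1 _ this)

end basic

section seq
variable {E : Type*} [AddCommGroup E] [Module ℝ E] {X : BanachENorm ℝ E}

lemma wt_banach {S : (ℤ → E) → ℝ≥0∞} (h : IsBanachENorm ℝ S) {a : ℝ} (ha : 0 < a) :
    IsBanachENorm ℝ (wtSeq a S) := by
  have hak : ∀ k : ℤ, a ^ k ≠ 0 := fun k => (zpow_pos ha k).ne'
  refine ⟨fun x hx => ?_, fun x y => ?_, fun c x => ?_, fun f hf hc => ?_⟩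
  · have := h.1 _ hx
    funext k
    have h2 := congrFun this k
    simpa [hak k] using h2
  · have : (fun k => a ^ k • (x + y) k) = (fun k => a ^ k • x k) + fun k => a ^ k • y k := by
      funext k; simp
    simp only [wtSeq]
    rw [this]
    exact h.2.1 _ _
  · have : (fun k => a ^ k • (c • x) k) = c • (fun k => a ^ k • x k) := by
      funext k; exact smul_comm _ _ _
    simp only [wtSeq]
    rw [this]
    exact h.2.2.1 _ _
  · have hs : ∀ x y : ℤ → E, (fun k => a ^ k • x k) - (fun k => a ^ k • y k)
        = fun k => a ^ k • (x - y) k := by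
      intro x y; funext k; simp [smul_sub]
    obtain ⟨y, hy, hl⟩ := h.2.2.2 (fun n k => a ^ k • f n k) hf (by
      intro ε hε
      obtain ⟨n₀, hn₀⟩ := hc ε hε
      refine ⟨n₀, fun m hm n hn => ?_⟩
      rw [hs]
      exact hn₀ m hm n hn)
    have hy' : (fun k => a ^ k • ((a ^ k)⁻¹ • y k)) = y := by
      funext k; rw [smul_inv_smul₀ (hak k)]
    refine ⟨fun k => (a ^ k)⁻¹ • y k, ?_, ?_⟩
    · simp only [wtSeq]; rwa [hy']
    · simp only [wtSeq]
      have : ∀ n, (fun k => a ^ k • (f n - fun k => (a ^ k)⁻¹ • y k) k)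
          = (fun k => a ^ k • f n k) - y := by
        intro n
        rw [← hs, hy']
      simpa only [this] using hl

lemma wt_coord (S : SeqStructure ℝ E X) {a : ℝ} (ha : 0 < a) (x : ℤ → E) (k : ℤ) :
    X.toFun (x k) ≤ ENNReal.ofReal (a ^ (-k)) * wtSeq a S.toFun x := by
  have h1 : x k = a ^ (-k) • (a ^ k • x k) := by
    rw [smul_smul, ← zpow_add₀ ha.ne']; simp
  calc X.toFun (x k) = X.toFun (a ^ (-k) • (a ^ k • x k)) := by rw [← h1]
    _ ≤ ENNReal.ofReal (a ^ (-k)) * X.toFun (a ^ k • x k) :=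
        nsmul X.isBanachENorm (zpow_pos ha _).le _
    _ ≤ _ := by
        gcongr
        exact S.coord (fun k => a ^ k • x k) k

lemma wt_shift (S : SeqStructure ℝ E X) {a : ℝ} (ha : 0 < a) (x : ℤ → E) (n : ℤ) :
    wtSeq a S.toFun (fun k => x (k + n)) ≤ ENNReal.ofReal (a ^ (-n)) * wtSeq a S.toFun x := by
  have h1 : (fun k => a ^ k • x (k + n)) = a ^ (-n) • (fun k => a ^ (k + n) • x (k + n)) := by
    funext k
    simp only [Pi.smul_apply]
    rw [smul_smul, ← zpow_add₀ ha.ne']; congr 2; ring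
  simp only [wtSeq]
  rw [h1]
  refine (nsmul S.isBanachENorm (zpow_pos ha _).le _).trans ?_
  rw [S.shift (fun k => a ^ k • x k) n]

/-- The `ℓ¹` bound. -/
lemma S_le_tsum (S : SeqStructure ℝ E X) (z : ℤ → E) :
    S.toFun z ≤ ∑' k, X.toFun (z k) := by
  by_cases hT : ∑' k, X.toFun (z k) = ∞
  · rw [hT]; exact le_top
  let e := Equiv.intEquivNat
  let f : ℕ → ℤ → E := fun i k => if k = e.symm i then z (e.symm i) else 0
  have hf : ∀ i, S.toFun (f i) = X.toFun (z (e.symm i)) := fun i => S.single _ _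
  have hsum : ∑' i, S.toFun (f i) = ∑' k, X.toFun (z k) := by
    simp only [hf]
    exact e.symm.tsum_eq (fun k => X.toFun (z k))
  obtain ⟨y, hy, hl⟩ := nseries S.isBanachENorm f (by rwa [hsum])
  have : z = y := by
    funext k
    have h1 : Tendsto (fun n => X.toFun ((∑ i ∈ Finset.range n, f i) k - y k)) atTop (𝓝 0) :=
      tendsto_of_tendsto_of_tendsto_of_le_of_le tendsto_const_nhds hl (fun _ => zero_le)
        (fun n => S.coord (∑ i ∈ Finset.range n, f i - y) k)
    have h2 : Tendsto (fun n => X.toFun ((∑ i ∈ Finset.range n, f i) k - z k)) atTop (𝓝 0) := by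
      refine tendsto_const_nhds.congr' ?_
      filter_upwards [eventually_gt_atTop (e k)] with n hn
      have : (∑ i ∈ Finset.range n, f i) k = z k := by
        rw [Finset.sum_apply, Finset.sum_eq_single (e k)]
        · simp [f]
        · intro b _ hb
          have : k ≠ e.symm b := by
            rintro rfl; simp at hb
          simp [f, this]
        · intro hh; exact absurd (Finset.mem_range.2 hn) hh
      rw [this, sub_self, nzero X.isBanachENorm]
    exact nuniq X.isBanachENorm h2 h1
  rw [this]
  rwa [hsum, this] at hy

/-- Cesàro coefficient. -/
noncomputable def phi (n : ℕ) (k : ℤ) : ℝ :=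
  (n + 1 : ℝ)⁻¹ * ∑ m ∈ Finset.range (n + 1), (if |k| ≤ (m : ℤ) then (1 : ℝ) else 0)

lemma cesaro_eq (n : ℕ) (x : ℤ → E) : cesaro ℝ n x = fun k => phi n k • x k := by
  funext k
  simp only [cesaro, phi, mul_smul, Finset.sum_smul, ite_smul, one_smul, zero_smul]

lemma phi_nonneg (n : ℕ) (k : ℤ) : 0 ≤ phi n k := by
  unfold phi
  refine mul_nonneg (by positivity) (Finset.sum_nonneg fun i _ => ?_)
  split_ifs <;> norm_num

lemma phi_le_one (n : ℕ) (k : ℤ) : phi n k ≤ 1 := by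
  unfold phi
  rw [inv_mul_le_iff₀ (by positivity)]
  calc _ ≤ ∑ m ∈ Finset.range (n + 1), (1 : ℝ) :=
        Finset.sum_le_sum fun i _ => by split_ifs <;> norm_num
    _ = _ := by simp

lemma phi_eq_zero {n : ℕ} {k : ℤ} (h : (n : ℤ) < |k|) : phi n k = 0 := by
  unfold phi
  rw [Finset.sum_eq_zero, mul_zero]
  intro m hm
  rw [if_neg]
  have := Finset.mem_range.1 hm
  omega

lemma one_sub_phi_le (n : ℕ) (k : ℤ) : 1 - phi n k ≤ k.natAbs / (n + 1 : ℝ) := by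
  have hn : (0 : ℝ) < n + 1 := by positivity
  have h1 : 1 - phi n k = (n + 1 : ℝ)⁻¹ *
      ∑ m ∈ Finset.range (n + 1), (if |k| ≤ (m : ℤ) then (0 : ℝ) else 1) := by
    have : (1 : ℝ) = (n + 1 : ℝ)⁻¹ * ∑ m ∈ Finset.range (n + 1), (1 : ℝ) := by
      simp; field_simp
    unfold phi
    refine (congrArg (fun t : ℝ => t - (n + 1 : ℝ)⁻¹ * ∑ m ∈ Finset.range (n + 1),
      (if |k| ≤ (m : ℤ) then (1 : ℝ) else 0)) this).trans ?_
    rw [← mul_sub, ← Finset.sum_sub_distrib]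
    congr 1
    refine Finset.sum_congr rfl fun m _ => ?_
    split_ifs <;> norm_num
  rw [h1, div_eq_inv_mul]
  gcongr
  calc _ = ∑ m ∈ Finset.range (n + 1), (if m < k.natAbs then (1 : ℝ) else 0) := by
        refine Finset.sum_congr rfl fun m _ => ?_
        by_cases hm : m < k.natAbs
        · rw [if_pos hm, if_neg (by rw [Int.abs_eq_natAbs]; omega)]
        · rw [if_neg hm, if_pos (by rw [Int.abs_eq_natAbs]; omega)]
    _ = (((Finset.range (n + 1)).filter (fun m => m < k.natAbs)).card : ℝ) := by
        rw [Finset.sum_boole]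
    _ ≤ _ := by
        have : (Finset.range (n + 1)).filter (fun m => m < k.natAbs) ⊆ Finset.range k.natAbs := by
          intro m hm
          simp at hm ⊢; omega
        have := Finset.card_le_card this
        rw [Finset.card_range] at this
        exact_mod_cast this

lemma phi_tendsto (k : ℤ) : Tendsto (fun n => ENNReal.ofReal (1 - phi n k)) atTop (𝓝 0) := by
  have h1 : Tendsto (fun n : ℕ => (k.natAbs : ℝ) / (n + 1 : ℝ)) atTop (𝓝 0) := by
    refine ((tendsto_const_div_atTop_nhds_zero_nat (k.natAbs : ℝ)).comp
      (tendsto_add_atTop_nat 1)).congr fun n => ?_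
    simp
  have h2 : Tendsto (fun n => 1 - phi n k) atTop (𝓝 0) :=
    tendsto_of_tendsto_of_tendsto_of_le_of_le tendsto_const_nhds h1
      (fun n => by have := phi_le_one n k; simp only; linarith) (fun n => one_sub_phi_le n k)
  simpa using ENNReal.tendsto_ofReal h2

lemma phi_dct (b : ℤ → ℝ≥0∞) (hb : ∑' k, b k ≠ ∞) :
    Tendsto (fun n => ∑' k, ENNReal.ofReal (1 - phi n k) * b k) atTop (𝓝 0) := by
  have h := MeasureTheory.tendsto_lintegral_of_dominated_convergence
    (μ := MeasureTheory.Measure.count) (F := fun n (k : ℤ) => ENNReal.ofReal (1 - phi n k) * b k)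
    (f := fun _ => 0) b (fun n => measurable_of_countable _)
    (fun n => Filter.Eventually.of_forall fun k => by
      calc _ ≤ 1 * b k := by
            refine mul_le_mul_left ?_ _
            rw [ENNReal.ofReal_le_one]
            have := phi_nonneg n k; linarith
        _ = b k := one_mul _)
    (by rwa [MeasureTheory.lintegral_count])
    (Filter.Eventually.of_forall fun k => by
      have hk : b k ≠ ∞ := ENNReal.ne_top_of_tsum_ne_top hb k
      simpa using ENNReal.Tendsto.mul_const (phi_tendsto k) (Or.inr hk))
  simpa [MeasureTheory.lintegral_count] using h

lemma wt_cesaro {S : SeqStructure ℝ E X} (hS : IsLinftySeqStructure S) (a : ℝ) (n : ℕ)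
    (x : ℤ → E) : wtSeq a S.toFun (fun k => phi n k • x k) ≤ wtSeq a S.toFun x := by
  have := hS n (fun k => a ^ k • x k)
  rw [cesaro_eq] at this
  have h2 : (fun k => a ^ k • phi n k • x k) = fun k => phi n k • a ^ k • x k := by
    funext k; exact smul_comm _ _ _
  simp only [wtSeq]
  rwa [h2]

lemma fin_tsum {b : ℤ → ℝ≥0∞} (hf : (Function.support b).Finite) (hb : ∀ k, b k ≠ ∞) :
    ∑' k, b k ≠ ∞ := by
  rw [tsum_eq_sum (s := hf.toFinset) (fun k hk => by simpa using hk)]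
  exact ENNReal.sum_ne_top.2 fun k _ => hb k

lemma memSeqClos_cesaro {S : SeqStructure ℝ E X} (hS : IsLinftySeqStructure S)
    {N : E → ℝ≥0∞} {x : ℤ → E} (hx : memSeqClos S.toFun X.toFun N x) :
    Tendsto (fun n => S.toFun (cesaro ℝ n x - x)) atTop (𝓝 0) := by
  rw [ENNReal.tendsto_nhds_zero]
  intro ε hε
  have hε3 : 0 < ε / 3 := ENNReal.div_pos hε.ne' (by simp)
  obtain ⟨y, hyf, hym, hxy⟩ := hx.2 (ε / 3) hε3
  have hB := S.isBanachENorm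
  have hlim : Tendsto (fun n => ∑' k, ENNReal.ofReal (1 - phi n k) * X.toFun (y k)) atTop
      (𝓝 0) := by
    refine phi_dct _ (fin_tsum (hyf.subset ?_) fun k => (hym k).1)
    intro k hk hyk
    apply hk
    simp only [hyk]
    exact nzero X.isBanachENorm
  filter_upwards [hlim.eventually (gt_mem_nhds hε3)] with n hn
  have h1 : cesaro ℝ n x - x = (cesaro ℝ n (x - y) - (fun k => (1 - phi n k) • y k)) - (x - y) := by
    simp only [cesaro_eq]
    funext k
    simp only [Pi.sub_apply, smul_sub, sub_smul, one_smul]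
    abel
  have h2 : S.toFun (fun k => (1 - phi n k) • y k) ≤ ε / 3 := by
    refine (S_le_tsum S _).trans (le_trans ?_ hn.le)
    exact ENNReal.tsum_le_tsum fun k =>
      nsmul X.isBanachENorm (by have := phi_le_one n k; linarith) _
  calc S.toFun (cesaro ℝ n x - x) ≤ (S.toFun (cesaro ℝ n (x - y))
        + S.toFun (fun k => (1 - phi n k) • y k)) + S.toFun (x - y) := by
        rw [h1]
        exact (nsub hB _ _).trans (by gcongr; exact nsub hB _ _)
    _ ≤ ε / 3 + ε / 3 + ε / 3 := by
        gcongr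
        exact (hS n _).trans hxy.le
    _ = ε := ENNReal.add_thirds ε

end seq

section interp
variable {E : Type*} [NormedAddCommGroup E] [NormedSpace ℝ E] {N₀ N₁ : BanachENorm ℝ E}

/-- The interpolation norm with general weights. -/
noncomputable def I (p q : ℝ) (S₀ S₁ : (ℤ → E) → ℝ≥0∞) (v : E) : ℝ≥0∞ :=
  ⨅ (x : ℤ → E) (_ : HasSum x v), max (wtSeq p S₀ x) (wtSeq q S₁ x)

lemma I_le {p q : ℝ} {S₀ S₁ : (ℤ → E) → ℝ≥0∞} {v : E} {x : ℤ → E} (hx : HasSum x v) :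
    I p q S₀ S₁ v ≤ max (wtSeq p S₀ x) (wtSeq q S₁ x) := iInf₂_le x hx

lemma I_lt {p q : ℝ} {S₀ S₁ : (ℤ → E) → ℝ≥0∞} {v : E} {A : ℝ≥0∞} (h : I p q S₀ S₁ v < A) :
    ∃ x, HasSum x v ∧ wtSeq p S₀ x < A ∧ wtSeq q S₁ x < A := by
  simp only [I, iInf_lt_iff, max_lt_iff] at h
  obtain ⟨x, hx, h⟩ := h
  exact ⟨x, hx, h⟩

lemma enorm_le₀ (hcomp : ∀ v : E, enSum N₀.toFun N₁.toFun v = (‖v‖₊ : ℝ≥0∞)) (v : E) :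
    ‖v‖ₑ ≤ N₀.toFun v := by
  have h := hcomp v
  have h2 : enSum N₀.toFun N₁.toFun v ≤ _ := iInf_le _ v
  rw [h] at h2
  change (‖v‖₊ : ℝ≥0∞) ≤ _
  simpa [nzero N₁.isBanachENorm] using h2

lemma enorm_le₁ (hcomp : ∀ v : E, enSum N₀.toFun N₁.toFun v = (‖v‖₊ : ℝ≥0∞)) (v : E) :
    ‖v‖ₑ ≤ N₁.toFun v := by
  have h := hcomp v
  have h2 : enSum N₀.toFun N₁.toFun v ≤ _ := iInf_le _ 0
  rw [h] at h2
  change (‖v‖₊ : ℝ≥0∞) ≤ _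
  simpa [nzero N₀.isBanachENorm] using h2

lemma tendsto_of_N {N : E → ℝ≥0∞} (hN : ∀ v, ‖v‖ₑ ≤ N v) {f : ℕ → E} {x : E}
    (h : Tendsto (fun n => N (f n - x)) atTop (𝓝 0)) : Tendsto f atTop (𝓝 x) := by
  rw [tendsto_iff_edist_tendsto_0]
  refine tendsto_of_tendsto_of_tendsto_of_le_of_le tendsto_const_nhds h (fun _ => zero_le)
    fun n => ?_
  simp only [edist_eq_enorm_sub]
  exact hN _

lemma zpow_bound₀ {p r : ℝ} (hp : 0 < p) (hpr : p ≤ r) {k : ℤ} (hk : 0 ≤ k) :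
    p ^ k ≤ r ^ k.natAbs := by
  obtain ⟨n, rfl⟩ := Int.eq_ofNat_of_zero_le hk
  simp only [Int.natAbs_natCast, zpow_natCast]
  exact pow_le_pow_left₀ hp.le hpr n

lemma zpow_bound₁ {q r : ℝ} (hq : 0 < q) (hqr : q⁻¹ ≤ r) {k : ℤ} (hk : k ≤ 0) :
    q ^ k ≤ r ^ k.natAbs := by
  have := zpow_bound₀ (inv_pos.2 hq) hqr (k := -k) (by omega)
  simpa using this

/-- Two-sided geometric sum. -/
noncomputable def G (r : ℝ) : ℝ≥0∞ := ∑' k : ℤ, ENNReal.ofReal (r ^ k.natAbs)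

lemma G_ne_top {r : ℝ} (h0 : 0 ≤ r) (hr : r < 1) : G r ≠ ∞ := by
  have h1 := summable_geometric_of_lt_one h0 hr
  have : Summable (fun k : ℤ => r ^ k.natAbs) :=
    Summable.of_nat_of_neg (by simpa using h1) (by simpa using h1)
  exact this.tsum_ofReal_ne_top

/-- One-sided geometric sum. -/
noncomputable def R (r : ℝ) : ℝ≥0∞ := ∑' i : ℕ, ENNReal.ofReal (r ^ i)

lemma R_ne_top {r : ℝ} (h0 : 0 ≤ r) (hr : r < 1) : R r ≠ ∞ :=
  (summable_geometric_of_lt_one h0 hr).tsum_ofReal_ne_top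

lemma I_sub {S₀ : SeqStructure ℝ E N₀} {S₁ : SeqStructure ℝ E N₁} {p q : ℝ} (hp : 0 < p)
    (hq : 0 < q) {a b : E} {A B : ℝ≥0∞} (ha : I p q S₀.toFun S₁.toFun a < A)
    (hb : I p q S₀.toFun S₁.toFun b < B) : I p q S₀.toFun S₁.toFun (a - b) < A + B := by
  obtain ⟨x, hx, hx0, hx1⟩ := I_lt ha
  obtain ⟨y, hy, hy0, hy1⟩ := I_lt hb
  refine (I_le (hx.sub hy)).trans_lt (max_lt ?_ ?_)
  · exact (nsub (wt_banach S₀.isBanachENorm hp) x y).trans_lt (ENNReal.add_lt_add hx0 hy0)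
  · exact (nsub (wt_banach S₁.isBanachENorm hq) x y).trans_lt (ENNReal.add_lt_add hx1 hy1)

lemma norm_fin (hcomp : ∀ v : E, enSum N₀.toFun N₁.toFun v = (‖v‖₊ : ℝ≥0∞))
    (S₀ : SeqStructure ℝ E N₀) (S₁ : SeqStructure ℝ E N₁) {p q r : ℝ} (hp : 0 < p) (hpr : p ≤ r)
    (hq : 0 < q) (hqr : q⁻¹ ≤ r) {x : ℤ → E} {A : ℝ≥0∞} (h0 : wtSeq p S₀.toFun x ≤ A)
    (h1 : wtSeq q S₁.toFun x ≤ A) (F : Finset ℤ) : ‖∑ k ∈ F, x k‖ₑ ≤ G r * A := by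
  calc ‖∑ k ∈ F, x k‖ₑ ≤ ∑ k ∈ F, ‖x k‖ₑ := enorm_sum_le _ _
    _ ≤ ∑ k ∈ F, ENNReal.ofReal (r ^ k.natAbs) * A := by
        refine Finset.sum_le_sum fun k _ => ?_
        rcases le_total k 0 with hk | hk
        · refine (enorm_le₀ hcomp _).trans ((wt_coord S₀ hp x k).trans ?_)
          gcongr
          simpa using zpow_bound₀ hp hpr (k := -k) (by omega)
        · refine (enorm_le₁ hcomp _).trans ((wt_coord S₁ hq x k).trans ?_)
          gcongr
          simpa using zpow_bound₁ hq hqr (k := -k) (by omega)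
    _ = (∑ k ∈ F, ENNReal.ofReal (r ^ k.natAbs)) * A := by rw [Finset.sum_mul]
    _ ≤ _ := by gcongr; exact ENNReal.sum_le_tsum _

lemma norm_I (hcomp : ∀ v : E, enSum N₀.toFun N₁.toFun v = (‖v‖₊ : ℝ≥0∞))
    (S₀ : SeqStructure ℝ E N₀) (S₁ : SeqStructure ℝ E N₁) {p q r : ℝ} (hp : 0 < p) (hpr : p ≤ r)
    (hq : 0 < q) (hqr : q⁻¹ ≤ r) {v : E} {A : ℝ≥0∞} (h : I p q S₀.toFun S₁.toFun v < A) :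
    ‖v‖ₑ ≤ G r * A := by
  obtain ⟨x, hx, h0, h1⟩ := I_lt h
  exact le_of_tendsto' (Filter.Tendsto.enorm hx)
    (fun F => norm_fin hcomp S₀ S₁ hp hpr hq hqr h0.le h1.le F)

lemma wt_tail {X : BanachENorm ℝ E} (S : SeqStructure ℝ E X) {a r : ℝ} (ha : 0 < a) (u : E)
    (P : ℤ → Prop) [DecidablePred P] (hP : ∀ k, P k → a ^ k ≤ r ^ k.natAbs) (n : ℕ) :
    wtSeq a S.toFun (fun k => (1 - phi n k) • (if P k then u else 0)) ≤
      ∑' k : ℤ, ENNReal.ofReal (1 - phi n k) * (ENNReal.ofReal (r ^ k.natAbs) * X.toFun u) := by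
  have hX := X.isBanachENorm
  refine (S_le_tsum S _).trans (ENNReal.tsum_le_tsum fun k => ?_)
  rw [smul_comm]
  refine (nsmul hX (by have := phi_le_one n k; linarith) _).trans ?_
  gcongr
  split_ifs with hk
  · refine (nsmul hX (zpow_pos ha _).le _).trans ?_
    gcongr
    exact hP k hk
  · simp [nzero hX]

lemma tail_tendsto {r : ℝ} (h0 : 0 ≤ r) (hr : r < 1) {c : ℝ≥0∞} (hc : c ≠ ∞) :
    Tendsto (fun n => ∑' k : ℤ, ENNReal.ofReal (1 - phi n k) *
      (ENNReal.ofReal (r ^ k.natAbs) * c)) atTop (𝓝 0) := by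
  refine phi_dct _ ?_
  rw [ENNReal.tsum_mul_right]
  exact ENNReal.mul_ne_top (G_ne_top h0 hr) hc

lemma series_shift {X : BanachENorm ℝ E} (S : SeqStructure ℝ E X) {a r : ℝ} (ha : 0 < a)
    (h0 : 0 ≤ r) (hr : r < 1) {x : ℤ → E} {A : ℝ≥0∞} (hA : A ≠ ∞) (hx : wtSeq a S.toFun x ≤ A)
    (s : ℕ → ℤ) (hs : ∀ i, a ^ (-(s i)) ≤ r ^ i) :
    ∃ W : ℤ → E, wtSeq a S.toFun W ≤ R r * A ∧ ∀ k,
      Tendsto (fun n => X.toFun (∑ i ∈ Finset.range n, x (k + s i) - W k)) atTop (𝓝 0) := by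
  have hb : ∑' i, wtSeq a S.toFun (fun k => x (k + s i)) ≤ R r * A := by
    rw [R, ← ENNReal.tsum_mul_right]
    refine ENNReal.tsum_le_tsum fun i => (wt_shift S ha x (s i)).trans ?_
    gcongr
    exact hs i
  obtain ⟨W, hW, hl⟩ := nseries (wt_banach S.isBanachENorm ha) (fun i k => x (k + s i))
    (ne_top_of_le_ne_top (ENNReal.mul_ne_top (R_ne_top h0 hr) hA) hb)
  refine ⟨W, hW.trans hb, fun k => ?_⟩
  have h1 := ENNReal.Tendsto.const_mul hl (a := ENNReal.ofReal (a ^ (-k)))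
    (Or.inr ENNReal.ofReal_ne_top)
  rw [mul_zero] at h1
  refine tendsto_of_tendsto_of_tendsto_of_le_of_le tendsto_const_nhds h1 (fun _ => zero_le)
    fun n => ?_
  have := wt_coord S ha (∑ i ∈ Finset.range n, (fun k => x (k + s i)) - W) k
  simpa [Finset.sum_apply] using this

lemma enInter_ne_top {x : E} : enInter N₀.toFun N₁.toFun x ≠ ∞ ↔
    N₀.toFun x ≠ ∞ ∧ N₁.toFun x ≠ ∞ := by
  simp [enInter]

lemma coord_ne_top {X : BanachENorm ℝ E} (S : SeqStructure ℝ E X) {a : ℝ} (ha : 0 < a)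
    {x : ℤ → E} (hx : wtSeq a S.toFun x ≠ ∞) (k : ℤ) : X.toFun (x k) ≠ ∞ :=
  ne_top_of_le_ne_top (ENNReal.mul_ne_top ENNReal.ofReal_ne_top hx) (wt_coord S ha x k)

lemma sum_ne_top {X : BanachENorm ℝ E} {ι : Type*} (F : Finset ι) {f : ι → E}
    (h : ∀ i ∈ F, X.toFun (f i) ≠ ∞) : X.toFun (∑ i ∈ F, f i) ≠ ∞ :=
  ne_top_of_le_ne_top (ENNReal.sum_ne_top.2 h) (nsum X.isBanachENorm _ _)

lemma sub_ne_top {X : BanachENorm ℝ E} {x y : E}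
    (hx : X.toFun x ≠ ∞) (hy : X.toFun y ≠ ∞) : X.toFun (x - y) ≠ ∞ :=
  ne_top_of_le_ne_top (ENNReal.add_ne_top.2 ⟨hx, hy⟩) (nsub X.isBanachENorm _ _)

lemma smul_ne_top {X : BanachENorm ℝ E} (c : ℝ) {x : E}
    (hx : X.toFun x ≠ ∞) : X.toFun (c • x) ≠ ∞ :=
  ne_top_of_le_ne_top (ENNReal.mul_ne_top ENNReal.coe_ne_top hx) (X.isBanachENorm.2.2.1 c x)

lemma hasSum_telescope {w : ℤ → E} {u : E} {n : ℕ} (h0 : ∀ k : ℤ, k < -n → w k = 0)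
    (h1 : ∀ k : ℤ, (n : ℤ) < k → w k = u) :
    (Function.support (fun k => w k - w (k - 1))).Finite ∧
      HasSum (fun k => w k - w (k - 1)) u := by
  have hz : ∀ k : ℤ, k < -n ∨ (n : ℤ) + 1 < k → w k - w (k - 1) = 0 := by
    rintro k (hk | hk)
    · rw [h0 k hk, h0 (k - 1) (by omega), sub_zero]
    · rw [h1 k (by omega), h1 (k - 1) (by omega), sub_self]
  constructor
  · refine (Set.finite_Icc (-(n : ℤ)) (n + 1)).subset fun k hk => ?_
    by_contra hk2
    apply hk
    apply hz
    simp only [Set.mem_Icc, not_and_or, not_le] at hk2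
    exact hk2
  · let g : ℕ → ℤ := fun i => (i : ℤ) - n
    have hg : Function.Injective g := fun i j hij => by
      simp only [g] at hij; omega
    rw [← hg.hasSum_iff]
    · have h2 : ∑ i ∈ Finset.range (2 * n + 2), ((fun k => w k - w (k - 1)) ∘ g) i = u := by
        have h3 := Finset.sum_range_sub (fun i : ℕ => w ((i : ℤ) - n - 1)) (2 * n + 2)
        rw [h1 _ (by push_cast; omega), h0 _ (by push_cast; omega), sub_zero] at h3
        rw [← h3]
        refine Finset.sum_congr rfl fun i _ => ?_
        simp only [Function.comp, g]
        congr 2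
        push_cast; ring
      suffices hh : HasSum ((fun k => w k - w (k - 1)) ∘ g)
          (∑ i ∈ Finset.range (2 * n + 2), ((fun k => w k - w (k - 1)) ∘ g) i) by
        rwa [h2] at hh
      refine hasSum_sum_of_ne_finset_zero fun i hi => ?_
      simp only [Finset.mem_range, not_lt] at hi
      exact hz _ (Or.inr (by simp only [g]; omega))
    · intro k hk
      apply hz
      left
      by_contra hlt
      exact hk ⟨(k + n).toNat, by simp only [g]; omega⟩

lemma wt_diff {X : BanachENorm ℝ E} (S : SeqStructure ℝ E X) {a b : ℝ} (ha : 0 < a) (hab : a ≤ b)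
    {w : ℤ → E} {B : ℝ≥0∞} (hw : wtSeq a S.toFun w ≤ B) :
    wtSeq a S.toFun (fun k => w k - w (k - 1)) ≤ (1 + ENNReal.ofReal b) * B := by
  have h1 := wt_shift S ha w (-1)
  have h2 := nsub (wt_banach S.isBanachENorm ha) w (fun k => w (k + -1))
  calc _ ≤ _ := h2
    _ ≤ B + ENNReal.ofReal b * B := by
      gcongr
      refine h1.trans ?_
      simp only [neg_neg, zpow_one]
      gcongr
    _ = _ := by ring

lemma stepA (hcomp : ∀ v : E, enSum N₀.toFun N₁.toFun v = (‖v‖₊ : ℝ≥0∞))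
    {S₀ : SeqStructure ℝ E N₀} {S₁ : SeqStructure ℝ E N₁}
    (hl₀ : IsLinftySeqStructure S₀) (hl₁ : IsLinftySeqStructure S₁) {p q r : ℝ} (hp : 0 < p)
    (hpr : p ≤ r) (hq : 0 < q) (hqr : q⁻¹ ≤ r) (hr : r < 1) {u : E} {A : ℝ≥0∞}
    (hu : enInter N₀.toFun N₁.toFun u ≠ ∞) (hA : I p q S₀.toFun S₁.toFun u < A) (hAt : A ≠ ∞) :
    ∃ y : ℤ → E, (Function.support y).Finite ∧ (∀ k, enInter N₀.toFun N₁.toFun (y k) ≠ ∞) ∧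
      HasSum y u ∧ wtSeq p S₀.toFun y ≤ (1 + ENNReal.ofReal q) * (R r + 1) * A ∧
      wtSeq q S₁.toFun y ≤ (1 + ENNReal.ofReal q) * (R r + 1) * A := by
  have hr0 : 0 ≤ r := hp.le.trans hpr
  have hpq : p ≤ q := by
    have h1 : q⁻¹ < 1 := hqr.trans_lt hr
    have h2 : 1 < q := (inv_lt_one₀ hq).1 h1
    linarith
  obtain ⟨hu0, hu1⟩ := enInter_ne_top.1 hu
  obtain ⟨x, hx, hx0, hx1⟩ := I_lt hA
  obtain ⟨W, hW, hWl⟩ := series_shift S₀ hp hr0 hr hAt hx0.le (fun i => -(i : ℤ)) (fun i => by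
    simpa using pow_le_pow_left₀ hp.le hpr i)
  obtain ⟨Z, hZ, hZl⟩ := series_shift S₁ hq hr0 hr hAt hx1.le (fun i => 1 + (i : ℤ)) (fun i => by
    have h1 : q ^ (-(1 + (i : ℤ))) = (q⁻¹) ^ (i + 1) := by
      rw [zpow_neg, inv_pow, ← zpow_natCast]; congr 2; push_cast; ring
    rw [h1]
    calc (q⁻¹) ^ (i + 1) ≤ r ^ (i + 1) := pow_le_pow_left₀ (inv_pos.2 hq).le hqr _
      _ ≤ r ^ i := pow_le_pow_of_le_one hr0 hr.le (Nat.le_succ i))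
  have hWZ : ∀ k, W k + Z k = u := by
    intro k
    have h1 := tendsto_of_N (enorm_le₀ hcomp) (hWl k)
    have h2 := tendsto_of_N (enorm_le₁ hcomp) (hZl k)
    have h3 : HasSum (fun j : ℤ => x (k + 1 + j)) u :=
      (Equiv.addLeft (k + 1)).hasSum_iff.2 hx
    have h4 := h3.nat_add_neg_add_one.tendsto_sum_nat
    refine tendsto_nhds_unique (h1.add h2) (h4.congr fun n => ?_)
    rw [← Finset.sum_add_distrib]
    refine Finset.sum_congr rfl fun i _ => ?_
    rw [add_comm]
    congr 2 <;> ring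
  obtain ⟨n, hn0, hn1⟩ : ∃ n, (∑' k : ℤ, ENNReal.ofReal (1 - phi n k) *
      (ENNReal.ofReal (r ^ k.natAbs) * N₀.toFun u)) < A ∧
      (∑' k : ℤ, ENNReal.ofReal (1 - phi n k) *
      (ENNReal.ofReal (r ^ k.natAbs) * N₁.toFun u)) < A := by
    have hA0 : 0 < A := zero_le.trans_lt hA
    exact (((tail_tendsto hr0 hr hu0).eventually (gt_mem_nhds hA0)).and
      ((tail_tendsto hr0 hr hu1).eventually (gt_mem_nhds hA0))).exists
  let w : ℤ → E := (fun k => phi n k • W k) + fun k => (1 - phi n k) • (if 0 < k then u else 0)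
  let z : ℤ → E := (fun k => phi n k • Z k) + fun k => (1 - phi n k) • (if k ≤ 0 then u else 0)
  have hwz : ∀ k, w k = u - z k := by
    intro k
    rw [eq_sub_iff_add_eq]
    have : w k + z k = phi n k • (W k + Z k) + (1 - phi n k) • u := by
      simp only [w, z, Pi.add_apply]
      rcases le_or_gt k 0 with hk | hk
      · rw [if_pos hk, if_neg (not_lt.2 hk), smul_add, smul_zero]; abel
      · rw [if_neg (not_le.2 hk), if_pos hk, smul_add, smul_zero]; abel
    rw [this, hWZ, ← add_smul]; simp
  have hw : wtSeq p S₀.toFun w ≤ (R r + 1) * A := by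
    refine (nadd (wt_banach S₀.isBanachENorm hp) _ _).trans ?_
    rw [add_mul, one_mul]
    gcongr
    · exact (wt_cesaro hl₀ p n W).trans hW
    · exact (wt_tail S₀ hp u _ (fun k hk => zpow_bound₀ hp hpr hk.le) n).trans hn0.le
  have hz : wtSeq q S₁.toFun z ≤ (R r + 1) * A := by
    refine (nadd (wt_banach S₁.isBanachENorm hq) _ _).trans ?_
    rw [add_mul, one_mul]
    gcongr
    · exact (wt_cesaro hl₁ q n Z).trans hZ
    · exact (wt_tail S₁ hq u _ (fun k hk => zpow_bound₁ hq hqr hk) n).trans hn1.le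
  have hRA : (R r + 1) * A ≠ ∞ :=
    ENNReal.mul_ne_top (ENNReal.add_ne_top.2 ⟨R_ne_top hr0 hr, ENNReal.one_ne_top⟩) hAt
  have hyz : (fun k => w k - w (k - 1)) = -(fun k => z k - z (k - 1)) := by
    funext k
    simp only [hwz, Pi.neg_apply]
    abel
  obtain ⟨hfin, hsum⟩ := hasSum_telescope (w := w) (u := u) (n := n)
    (fun k hk => by
      have h1 : phi n k = 0 := phi_eq_zero (by rw [lt_abs]; omega)
      simp [w, h1, show ¬ (0 < k) by omega])
    (fun k hk => by
      have h1 : phi n k = 0 := phi_eq_zero (by rw [lt_abs]; omega)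
      simp [w, h1, show 0 < k by omega])
  refine ⟨fun k => w k - w (k - 1), hfin, fun k => ?_, hsum, ?_, ?_⟩
  · refine enInter_ne_top.2 ⟨?_, ?_⟩
    · have h := fun k => coord_ne_top S₀ hp (ne_top_of_le_ne_top hRA hw) k
      exact sub_ne_top (h _) (h _)
    · have h := fun k => coord_ne_top S₁ hq (ne_top_of_le_ne_top hRA hz) k
      rw [hyz, Pi.neg_apply, nneg N₁.isBanachENorm]
      exact sub_ne_top (h _) (h _)
  · rw [mul_assoc]
    exact wt_diff S₀ hp hpq hw
  · rw [hyz, nneg (wt_banach S₁.isBanachENorm hq), mul_assoc]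
    exact wt_diff S₁ hq le_rfl hz

lemma wt_memSeqClos {X : BanachENorm ℝ E} (S : SeqStructure ℝ E X) {a : ℝ} {N : E → ℝ≥0∞}
    (hN : ∀ x, N x ≠ ∞ → ∀ c : ℝ, N (c • x) ≠ ∞) (hNX : ∀ x, X.toFun x ≤ N x)
    {Y : ℤ → E} (hY : wtSeq a S.toFun Y ≠ ∞) {P : ℕ → ℤ → E}
    (hP : ∀ n, (Function.support (P n)).Finite) (hPN : ∀ n k, N (P n k) ≠ ∞)
    (hl : Tendsto (fun n => wtSeq a S.toFun (P n - Y)) atTop (𝓝 0)) :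
    wtSeq a (seqClosENorm S.toFun X.toFun N) Y = wtSeq a S.toFun Y := by
  simp only [wtSeq, seqClosENorm]
  rw [if_pos]
  refine ⟨hY, fun ε hε => ?_⟩
  obtain ⟨n, hn⟩ := (hl.eventually (gt_mem_nhds hε)).exists
  refine ⟨fun k => a ^ k • P n k, (hP n).subset fun k hk hz => hk ?_, fun k => ?_, ?_⟩
  · simp only [hz, smul_zero]
  · have h1 := hN _ (hPN n k) (a ^ k)
    refine ⟨ne_top_of_le_ne_top h1 (hNX _), fun δ hδ => ⟨_, h1, ?_⟩⟩
    rwa [sub_self, nzero X.isBanachENorm]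
  · have : (fun k => a ^ k • Y k) - (fun k => a ^ k • P n k) =
        -(fun k => a ^ k • (P n - Y) k) := by
      funext k; simp [smul_sub]
    rw [this, nneg S.isBanachENorm]
    exact hn

lemma stepB (hcomp : ∀ v : E, enSum N₀.toFun N₁.toFun v = (‖v‖₊ : ℝ≥0∞))
    {S₀ : SeqStructure ℝ E N₀} {S₁ : SeqStructure ℝ E N₁}
    (hl₀ : IsLinftySeqStructure S₀) (hl₁ : IsLinftySeqStructure S₁) {p q r : ℝ} (hp : 0 < p)
    (hpr : p ≤ r) (hq : 0 < q) (hqr : q⁻¹ ≤ r) (hr : r < 1) {v : E} {A : ℝ≥0∞}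
    (hv : memClosIn (I p q S₀.toFun S₁.toFun) (enInter N₀.toFun N₁.toFun) v)
    (hA : I p q S₀.toFun S₁.toFun v < A) (hAt : A ≠ ∞) :
    I p q (seqClosENorm S₀.toFun N₀.toFun (enInter N₀.toFun N₁.toFun))
      (seqClosENorm S₁.toFun N₁.toFun (enInter N₀.toFun N₁.toFun)) v ≤
      (1 + ENNReal.ofReal q) * (R r + 1) * 8 * A := by
  have hr0 : 0 ≤ r := hp.le.trans hpr
  have hA0 : 0 < A := zero_le.trans_lt hA
  set C : ℝ≥0∞ := (1 + ENNReal.ofReal q) * (R r + 1) with hC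
  have hCt : C ≠ ∞ := ENNReal.mul_ne_top (ENNReal.add_ne_top.2
    ⟨ENNReal.one_ne_top, ENNReal.ofReal_ne_top⟩)
    (ENNReal.add_ne_top.2 ⟨R_ne_top hr0 hr, ENNReal.one_ne_top⟩)
  set h : ℝ≥0∞ := 2⁻¹ with hh
  have hh0 : ∀ n : ℕ, 0 < h ^ n := fun n => ENNReal.pow_pos (by simp [hh]) n
  have hh1 : h ≤ 1 := by simp [hh]
  have hht : ∀ n : ℕ, h ^ n ≠ ∞ := fun n =>
    ne_top_of_le_ne_top ENNReal.one_ne_top (pow_le_one' hh1 n)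
  choose u hu hvu using fun n : ℕ => hv.2 (A * h ^ n)
    (ENNReal.mul_pos hA0.ne' (hh0 n).ne')
  let d : ℕ → E := fun n => Nat.casesOn n (u 0) (fun m => u (m + 1) - u m)
  have hd : ∀ n, ∑ i ∈ Finset.range (n + 1), d i = u n := by
    intro n
    induction n with
    | zero => simp [d]
    | succ n ih => rw [Finset.sum_range_succ, ih]; simp [d]
  have hdi : ∀ n, enInter N₀.toFun N₁.toFun (d n) ≠ ∞ := by
    intro n
    cases n with
    | zero => exact hu 0
    | succ n =>
      have h1 := enInter_ne_top.1 (hu n)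
      have h2 := enInter_ne_top.1 (hu (n + 1))
      exact enInter_ne_top.2 ⟨sub_ne_top h2.1 h1.1, sub_ne_top h2.2 h1.2⟩
  have hdI : ∀ n, I p q S₀.toFun S₁.toFun (d n) < A * 4 * h ^ n := by
    intro n
    cases n with
    | zero =>
      have h1 := I_sub hp hq hA (hvu 0)
      rw [sub_sub_cancel] at h1
      refine h1.trans_le ?_
      calc A + A * h ^ 0 = A * 2 := by rw [pow_zero, mul_one, mul_two]
        _ ≤ A * 4 * h ^ 0 := by
          rw [pow_zero, mul_one]; gcongr; norm_num
    | succ n =>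
      have h1 := I_sub hp hq (hvu n) (hvu (n + 1))
      have h2 : v - u n - (v - u (n + 1)) = d (n + 1) := by simp [d]
      rw [h2] at h1
      refine h1.trans_le ?_
      calc A * h ^ n + A * h ^ (n + 1) ≤ A * h ^ n + A * h ^ n := by
            gcongr A * h ^ n + A * ?_
            exact pow_le_pow_right_of_le_one' hh1 (Nat.le_succ n)
        _ = A * 4 * h ^ (n + 1) := by
            have h3 : (4 : ℝ≥0∞) * h = 2 := by
              rw [show (4 : ℝ≥0∞) = 2 * 2 by norm_num, mul_assoc, hh,
                ENNReal.mul_inv_cancel (by simp) (by simp), mul_one]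
            calc _ = A * 2 * h ^ n := by ring
              _ = A * (4 * h) * h ^ n := by rw [h3]
              _ = _ := by ring
  choose y hyf hyN hys hy0 hy1 using fun n => stepA hcomp hl₀ hl₁ hp hpr hq hqr hr (hdi n) (hdI n)
    (ENNReal.mul_ne_top (ENNReal.mul_ne_top hAt (by simp)) (hht n))
  have hgeo : ∑' n : ℕ, C * (A * 4 * h ^ n) = C * 4 * A * 2 := by
    rw [ENNReal.tsum_mul_left, ENNReal.tsum_mul_left, ENNReal.tsum_geometric, hh,
      ENNReal.one_sub_inv_two, inv_inv]
    ring
  have hs0 : ∑' n, wtSeq p S₀.toFun (y n) ≤ C * 4 * A * 2 := hgeo ▸ ENNReal.tsum_le_tsum hy0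
  have hs1 : ∑' n, wtSeq q S₁.toFun (y n) ≤ C * 4 * A * 2 := hgeo ▸ ENNReal.tsum_le_tsum hy1
  have hft : C * 4 * A * 2 ≠ ∞ :=
    ENNReal.mul_ne_top (ENNReal.mul_ne_top (ENNReal.mul_ne_top hCt (by simp)) hAt) (by simp)
  obtain ⟨Y, hY, hYl⟩ := nseries (wt_banach S₀.isBanachENorm hp) y (ne_top_of_le_ne_top hft hs0)
  obtain ⟨Y', hY', hYl'⟩ := nseries (wt_banach S₁.isBanachENorm hq) y (ne_top_of_le_ne_top hft hs1)
  have lim : ∀ {X : BanachENorm ℝ E} (hX : ∀ v, ‖v‖ₑ ≤ X.toFun v) (S : SeqStructure ℝ E X) {a : ℝ}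
      (_ : 0 < a) (T : ℤ → E)
      (_ : Tendsto (fun n => wtSeq a S.toFun (∑ i ∈ Finset.range n, y i - T)) atTop (𝓝 0)) (k : ℤ),
      Tendsto (fun n => (∑ i ∈ Finset.range n, y i) k) atTop (𝓝 (T k)) := by
    intro X hX S a ha T hT k
    refine tendsto_of_N hX ?_
    have h1 := ENNReal.Tendsto.const_mul hT (a := ENNReal.ofReal (a ^ (-k)))
      (Or.inr ENNReal.ofReal_ne_top)
    rw [mul_zero] at h1
    exact tendsto_of_tendsto_of_tendsto_of_le_of_le tendsto_const_nhds h1 (fun _ => zero_le)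
      fun n => wt_coord S ha (∑ i ∈ Finset.range n, y i - T) k
  have hYY : Y' = Y := by
    funext k
    exact tendsto_nhds_unique (lim (enorm_le₁ hcomp) S₁ hq Y' hYl' k)
      (lim (enorm_le₀ hcomp) S₀ hp Y hYl k)
  subst hYY
  have hPf : ∀ n, (Function.support (∑ i ∈ Finset.range n, y i)).Finite := by
    intro n
    refine ((Finset.range n).finite_toSet.biUnion (fun i _ => hyf i)).subset ?_
    intro k hk
    by_contra hk2
    apply hk
    rw [Finset.sum_apply]
    refine Finset.sum_eq_zero fun i hi => ?_
    by_contra hne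
    exact hk2 (Set.mem_biUnion (Finset.mem_coe.2 hi) hne)
  have hPN : ∀ n k, enInter N₀.toFun N₁.toFun ((∑ i ∈ Finset.range n, y i) k) ≠ ∞ := by
    intro n k
    rw [Finset.sum_apply]
    exact enInter_ne_top.2 ⟨sum_ne_top _ fun i _ => (enInter_ne_top.1 (hyN i k)).1,
      sum_ne_top _ fun i _ => (enInter_ne_top.1 (hyN i k)).2⟩
  have hNs : ∀ x, enInter N₀.toFun N₁.toFun x ≠ ∞ → ∀ c : ℝ,
      enInter N₀.toFun N₁.toFun (c • x) ≠ ∞ := fun x hx c =>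
    enInter_ne_top.2 ⟨smul_ne_top c (enInter_ne_top.1 hx).1, smul_ne_top c (enInter_ne_top.1 hx).2⟩
  have hsum : HasSum Y' v := by
    have hU : Tendsto (fun n => ‖v - u n‖ₑ) atTop (𝓝 0) := by
      have h1 : Tendsto (fun n : ℕ => G r * A * h ^ n) atTop (𝓝 (G r * A * 0)) :=
        ENNReal.Tendsto.const_mul (ENNReal.tendsto_pow_atTop_nhds_zero_of_lt_one (by simp [hh]))
          (Or.inr (ENNReal.mul_ne_top (G_ne_top hr0 hr) hAt))
      rw [mul_zero] at h1
      refine tendsto_of_tendsto_of_tendsto_of_le_of_le tendsto_const_nhds h1 (fun _ => zero_le)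
        fun n => ?_
      simpa only [mul_assoc] using norm_I hcomp S₀ S₁ hp hpr hq hqr (hvu n)
    have hM : Tendsto (fun n => G r * (wtSeq p S₀.toFun (∑ i ∈ Finset.range n, y i - Y') +
        wtSeq q S₁.toFun (∑ i ∈ Finset.range n, y i - Y'))) atTop (𝓝 0) := by
      have := ENNReal.Tendsto.const_mul (hYl.add hYl') (a := G r) (Or.inr (G_ne_top hr0 hr))
      simpa using this
    have hM' := hM.comp (tendsto_add_atTop_nat 1)
    rw [HasSum, EMetric.tendsto_nhds]
    intro ε hε
    have hε3 : 0 < ε / 3 := ENNReal.div_pos hε.ne' (by simp)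
    obtain ⟨n, hn1, hn2⟩ := ((hU.eventually (gt_mem_nhds hε3)).and
      (hM'.eventually (gt_mem_nhds hε3))).exists
    simp only [Function.comp] at hn2
    have hPs : HasSum (∑ i ∈ Finset.range (n + 1), y i) (u n) := by
      rw [← hd n]
      have := hasSum_sum (s := Finset.range (n + 1)) (fun i _ => hys i)
      refine this.congr_fun fun k => Finset.sum_apply _ _ _
    rw [HasSum, EMetric.tendsto_nhds] at hPs
    filter_upwards [hPs (ε / 3) hε3] with F hF
    have h1 : edist (∑ k ∈ F, Y' k) (∑ k ∈ F, (∑ i ∈ Finset.range (n + 1), y i) k) < ε / 3 := by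
      rw [edist_comm, edist_eq_enorm_sub, ← Finset.sum_sub_distrib]
      exact (norm_fin hcomp S₀ S₁ hp hpr hq hqr le_self_add le_add_self F).trans_lt hn2
    have h2 : edist (u n) v < ε / 3 := by
      rwa [edist_comm, edist_eq_enorm_sub]
    calc edist (∑ k ∈ F, Y' k) v ≤ _ := edist_triangle4 _ _ _ _
      _ < ε / 3 + ε / 3 + ε / 3 := ENNReal.add_lt_add (ENNReal.add_lt_add h1 hF) h2
      _ = ε := ENNReal.add_thirds ε
  refine (I_le hsum).trans ?_
  rw [wt_memSeqClos S₀ hNs (fun x => le_max_left _ _)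
      (ne_top_of_le_ne_top hft (hY.trans hs0)) hPf hPN hYl,
    wt_memSeqClos S₁ hNs (fun x => le_max_right _ _)
      (ne_top_of_le_ne_top hft (hY'.trans hs1)) hPf hPN hYl']
  refine (max_le (hY.trans hs0) (hY'.trans hs1)).trans (le_of_eq ?_)
  ring

lemma wt_cesaro_sub (S : (ℤ → E) → ℝ≥0∞) (a : ℝ) (n : ℕ) (x : ℤ → E) :
    wtSeq a S (cesaro ℝ n x - x) =
      S (cesaro ℝ n (fun k => a ^ k • x k) - fun k => a ^ k • x k) := by
  simp only [wtSeq, cesaro_eq]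
  congr 1
  funext k
  simp only [Pi.sub_apply, smul_sub]
  rw [smul_comm]

lemma closure_crit {S₀ : SeqStructure ℝ E N₀} {S₁ : SeqStructure ℝ E N₁} {p q : ℝ} (hp : 0 < p)
    (hq : 0 < q) {v : E} {x : ℤ → E} (hx : HasSum x v) (h0 : wtSeq p S₀.toFun x ≠ ∞)
    (h1 : wtSeq q S₁.toFun x ≠ ∞)
    (h : ∀ ε : ℝ≥0∞, 0 < ε → ∃ (n : ℕ) (m : ℤ),
      ENNReal.ofReal (p ^ (-m)) * wtSeq p S₀.toFun (cesaro ℝ n x - x) < ε ∧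
      ENNReal.ofReal (q ^ (-m)) * wtSeq q S₁.toFun (cesaro ℝ n x - x) < ε) :
    memClosIn (I p q S₀.toFun S₁.toFun) (enInter N₀.toFun N₁.toFun) v := by
  refine ⟨ne_top_of_le_ne_top (by simp [h0, h1]) (I_le hx), fun ε hε => ?_⟩
  obtain ⟨n, m, hm0, hm1⟩ := h ε hε
  have hs : HasSum (cesaro ℝ n x) (∑ k ∈ Finset.Icc (-(n : ℤ)) n, cesaro ℝ n x k) := by
    refine hasSum_sum_of_ne_finset_zero fun k hk => ?_
    rw [cesaro_eq]
    simp only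
    rw [phi_eq_zero, zero_smul]
    rw [Finset.mem_Icc] at hk
    rw [lt_abs]
    omega
  refine ⟨∑ k ∈ Finset.Icc (-(n : ℤ)) n, cesaro ℝ n x k, ?_, ?_⟩
  · refine enInter_ne_top.2 ⟨sum_ne_top _ fun k _ => ?_, sum_ne_top _ fun k _ => ?_⟩
    · rw [cesaro_eq]; exact smul_ne_top _ (coord_ne_top S₀ hp h0 k)
    · rw [cesaro_eq]; exact smul_ne_top _ (coord_ne_top S₁ hq h1 k)
  · have hd : HasSum (fun k => (x - cesaro ℝ n x) (k + m)) _ :=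
      (Equiv.addRight m).hasSum_iff.2 (hx.sub hs)
    refine (I_le hd).trans_lt (max_lt ?_ ?_)
    · refine (wt_shift S₀ hp _ m).trans_lt ?_
      rwa [nsub_comm (wt_banach S₀.isBanachENorm hp)]
    · refine (wt_shift S₁ hq _ m).trans_lt ?_
      rwa [nsub_comm (wt_banach S₁.isBanachENorm hq)]

lemma seqClos_ge {X : BanachENorm ℝ E} (S : SeqStructure ℝ E X) (N : E → ℝ≥0∞) (a : ℝ)
    (x : ℤ → E) : wtSeq a S.toFun x ≤ wtSeq a (seqClosENorm S.toFun X.toFun N) x := by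
  simp only [wtSeq, seqClosENorm]
  split_ifs
  · exact le_rfl
  · exact le_top

lemma seqClos_tendsto {X : BanachENorm ℝ E} {S : SeqStructure ℝ E X}
    (hS : IsLinftySeqStructure S) {N : E → ℝ≥0∞} {a : ℝ}
    {x : ℤ → E} (h : wtSeq a (seqClosENorm S.toFun X.toFun N) x ≠ ∞) :
    Tendsto (fun n => wtSeq a S.toFun (cesaro ℝ n x - x)) atTop (𝓝 0) := by
  simp only [wtSeq, seqClosENorm] at h
  split_ifs at h with hm
  · simp only [wt_cesaro_sub]
    exact memSeqClos_cesaro hS hm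
  · exact absurd rfl h

lemma part1a {S₀ : SeqStructure ℝ E N₀} {S₁ : SeqStructure ℝ E N₁}
    (hl₀ : IsLinftySeqStructure S₀) (hl₁ : IsLinftySeqStructure S₁) {p q : ℝ} (hp : 0 < p)
    (hq : 0 < q) (v : E) :
    closENorm (I p q S₀.toFun S₁.toFun) (enInter N₀.toFun N₁.toFun) v ≤
    I p q (seqClosENorm S₀.toFun N₀.toFun (enInter N₀.toFun N₁.toFun))
      (seqClosENorm S₁.toFun N₁.toFun (enInter N₀.toFun N₁.toFun)) v := by
  refine le_iInf₂ fun x hx => ?_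
  set N := enInter N₀.toFun N₁.toFun
  by_cases hT : max (wtSeq p (seqClosENorm S₀.toFun N₀.toFun N) x)
      (wtSeq q (seqClosENorm S₁.toFun N₁.toFun N) x) = ∞
  · rw [hT]; exact le_top
  have hT0 := ne_top_of_le_ne_top hT (le_max_left _ _)
  have hT1 := ne_top_of_le_ne_top hT (le_max_right _ _)
  have h0 := seqClos_ge S₀ N p x
  have h1 := seqClos_ge S₁ N q x
  have hm : memClosIn (I p q S₀.toFun S₁.toFun) N v := by
    refine closure_crit hp hq hx (ne_top_of_le_ne_top hT0 h0) (ne_top_of_le_ne_top hT1 h1)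
      fun ε hε => ?_
    obtain ⟨n, hn⟩ := (((seqClos_tendsto hl₀ hT0).eventually (gt_mem_nhds hε)).and
      ((seqClos_tendsto hl₁ hT1).eventually (gt_mem_nhds hε))).exists
    exact ⟨n, 0, by simpa using hn⟩
  rw [closENorm, if_pos hm]
  exact (I_le hx).trans (max_le_max h0 h1)

lemma geo_small {a : ℝ} (ha : 0 < a) (ha1 : a < 1) {B ε : ℝ≥0∞} (hB : B ≠ ∞) (hε : 0 < ε) :
    ∃ m : ℕ, ENNReal.ofReal (a ^ m) * B < ε := by
  have h1 := ENNReal.tendsto_ofReal (tendsto_pow_atTop_nhds_zero_of_lt_one ha.le ha1)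
  have h2 := ENNReal.Tendsto.mul_const h1 (b := B) (Or.inr hB)
  rw [ENNReal.ofReal_zero, zero_mul] at h2
  exact (h2.eventually (gt_mem_nhds hε)).exists

lemma cesaro_bdd {X : BanachENorm ℝ E} {S : SeqStructure ℝ E X}
    (hS : IsLinftySeqStructure S) {a : ℝ} (ha : 0 < a) (x : ℤ → E) (n : ℕ) :
    wtSeq a S.toFun (cesaro ℝ n x - x) ≤ wtSeq a S.toFun x + wtSeq a S.toFun x := by
  refine (nsub (wt_banach S.isBanachENorm ha) _ _).trans ?_
  gcongr
  rw [cesaro_eq]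
  exact wt_cesaro hS a n x

lemma c0_tendsto {X : BanachENorm ℝ E} {S : SeqStructure ℝ E X}
    (hS : IsC0SeqStructure S) {a : ℝ} {x : ℤ → E} (hx : wtSeq a S.toFun x ≠ ∞) (c : ℝ) :
    Tendsto (fun n => ENNReal.ofReal c * wtSeq a S.toFun (cesaro ℝ n x - x)) atTop (𝓝 0) := by
  simp only [wt_cesaro_sub]
  simpa using ENNReal.Tendsto.const_mul (hS.2 _ hx) (a := ENNReal.ofReal c)
    (Or.inr ENNReal.ofReal_ne_top)

lemma part2 {S₀ : SeqStructure ℝ E N₀} {S₁ : SeqStructure ℝ E N₁}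
    (hl₀ : IsLinftySeqStructure S₀) (hl₁ : IsLinftySeqStructure S₁) {p q : ℝ} (hp : 0 < p)
    (hp1 : p < 1) (hq : 0 < q) (hq1 : q⁻¹ < 1) (hc : IsC0SeqStructure S₀ ∨ IsC0SeqStructure S₁)
    {v : E} (hv : I p q S₀.toFun S₁.toFun v ≠ ∞) :
    memClosIn (I p q S₀.toFun S₁.toFun) (enInter N₀.toFun N₁.toFun) v := by
  obtain ⟨x, hx, hx0, hx1⟩ := I_lt (lt_top_iff_ne_top.2 hv)
  refine closure_crit hp hq hx hx0.ne hx1.ne fun ε hε => ?_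
  rcases hc with hc | hc
  · obtain ⟨m, hm⟩ := geo_small (inv_pos.2 hq) hq1 (ENNReal.add_ne_top.2 ⟨hx1.ne, hx1.ne⟩) hε
    obtain ⟨n, hn⟩ := ((c0_tendsto hc hx0.ne (p ^ (-(m : ℤ)))).eventually (gt_mem_nhds hε)).exists
    refine ⟨n, m, hn, lt_of_le_of_lt ?_ hm⟩
    rw [zpow_neg, zpow_natCast, inv_pow]
    gcongr
    exact cesaro_bdd hl₁ hq x n
  · obtain ⟨m, hm⟩ := geo_small hp hp1 (ENNReal.add_ne_top.2 ⟨hx0.ne, hx0.ne⟩) hε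
    obtain ⟨n, hn⟩ := ((c0_tendsto hc hx1.ne (q ^ (m : ℤ))).eventually (gt_mem_nhds hε)).exists
    refine ⟨n, -m, lt_of_le_of_lt ?_ hm, by rwa [neg_neg]⟩
    rw [neg_neg, zpow_natCast]
    gcongr
    exact cesaro_bdd hl₀ hp x n

lemma part1b (hcomp : ∀ v : E, enSum N₀.toFun N₁.toFun v = (‖v‖₊ : ℝ≥0∞))
    {S₀ : SeqStructure ℝ E N₀} {S₁ : SeqStructure ℝ E N₁}
    (hl₀ : IsLinftySeqStructure S₀) (hl₁ : IsLinftySeqStructure S₁) {p q : ℝ} (hp : 0 < p)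
    (hp1 : p < 1) (hq : 0 < q) (hq1 : q⁻¹ < 1) :
    ∃ C : ℝ≥0∞, 1 ≤ C ∧ C ≠ ∞ ∧ ∀ v : E,
      memClosIn (I p q S₀.toFun S₁.toFun) (enInter N₀.toFun N₁.toFun) v →
      I p q (seqClosENorm S₀.toFun N₀.toFun (enInter N₀.toFun N₁.toFun))
      (seqClosENorm S₁.toFun N₁.toFun (enInter N₀.toFun N₁.toFun)) v ≤
      C * I p q S₀.toFun S₁.toFun v := by
  set r := max p q⁻¹
  have hr : r < 1 := max_lt hp1 hq1
  have hr0 : 0 ≤ r := hp.le.trans (le_max_left _ _)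
  have hCt : (1 + ENNReal.ofReal q) * (R r + 1) * 8 ≠ ∞ :=
    ENNReal.mul_ne_top (ENNReal.mul_ne_top (ENNReal.add_ne_top.2
    ⟨ENNReal.one_ne_top, ENNReal.ofReal_ne_top⟩)
    (ENNReal.add_ne_top.2 ⟨R_ne_top hr0 hr, ENNReal.one_ne_top⟩)) (by simp)
  refine ⟨(1 + ENNReal.ofReal q) * (R r + 1) * 8, ?_, hCt, fun v hv => ?_⟩
  · calc (1 : ℝ≥0∞) = 1 * 1 * 1 := by simp
      _ ≤ _ := by
        gcongr
        · exact le_self_add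
        · exact le_add_self
        · norm_num
  · set C := (1 + ENNReal.ofReal q) * (R r + 1) * 8
    set a := I p q S₀.toFun S₁.toFun v with ha
    have hat : a ≠ ∞ := hv.1
    have h1 : ∀ n : ℕ, I p q (seqClosENorm S₀.toFun N₀.toFun (enInter N₀.toFun N₁.toFun))
        (seqClosENorm S₁.toFun N₁.toFun (enInter N₀.toFun N₁.toFun)) v
        ≤ C * (a + ((n : ℝ≥0∞) + 1)⁻¹) := by
      intro n
      have hi : ((n : ℝ≥0∞) + 1)⁻¹ ≠ 0 := by simp
      have hi2 : ((n : ℝ≥0∞) + 1)⁻¹ ≠ ∞ := by simp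
      exact stepB hcomp hl₀ hl₁ hp (le_max_left _ _) hq (le_max_right _ _) hr hv
        (ENNReal.lt_add_right hat hi) (ENNReal.add_ne_top.2 ⟨hat, hi2⟩)
    have h2 : Tendsto (fun n : ℕ => ((n : ℝ≥0∞) + 1)⁻¹) atTop (𝓝 0) := by
      refine (ENNReal.tendsto_inv_nat_nhds_zero.comp (tendsto_add_atTop_nat 1)).congr fun n => ?_
      simp
    have h3 := ENNReal.Tendsto.const_mul (tendsto_const_nhds (x := a) |>.add h2) (a := C)
      (Or.inr hCt)
    rw [add_zero] at h3
    exact ge_of_tendsto' h3 h1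

end interp

end ISS

/-- For `ℓ∞`-sequence structures, `(𝒳₀,𝒳₁)_θ^∘ = (𝒳₀^∘,𝒳₁^∘)_θ` with
equivalent norms, and if moreover `𝔖₀` or `𝔖₁` is a `c₀`-sequence structure, then
`(𝒳₀,𝒳₁)_θ = (𝒳₀^∘,𝒳₁^∘)_θ` with equivalent norms.  Here `X_j^∘` is the closure of
`X₀ ∩ X₁` in `X_j`, `𝔖_j^∘` is the closure in `𝔖_j` of the finitely nonzero
`X_j^∘`-valued sequences and `(𝒳₀,𝒳₁)_θ^∘` is the closure of `X₀ ∩ X₁` in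
`(𝒳₀,𝒳₁)_θ`. -/
theorem statement5 {E : Type u} [NormedAddCommGroup E] [NormedSpace ℝ E]
    (N₀ N₁ : BanachENorm ℝ E)
    (hcomp : ∀ v : E, enSum N₀.toFun N₁.toFun v = (‖v‖₊ : ℝ≥0∞))
    (S₀ : SeqStructure ℝ E N₀) (S₁ : SeqStructure ℝ E N₁)
    (hl₀ : IsLinftySeqStructure S₀) (hl₁ : IsLinftySeqStructure S₁)
    (θ : ℝ) (hθ : θ ∈ Set.Ioo (0 : ℝ) 1) :
    (∃ C : ℝ≥0∞, C ≠ ∞ ∧ ∀ v : E,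
      (closENorm (interpENorm S₀.toFun S₁.toFun θ) (enInter N₀.toFun N₁.toFun) v ≤
        C * interpENorm
          (seqClosENorm S₀.toFun N₀.toFun (enInter N₀.toFun N₁.toFun))
          (seqClosENorm S₁.toFun N₁.toFun (enInter N₀.toFun N₁.toFun)) θ v) ∧
      (interpENorm
          (seqClosENorm S₀.toFun N₀.toFun (enInter N₀.toFun N₁.toFun))
          (seqClosENorm S₁.toFun N₁.toFun (enInter N₀.toFun N₁.toFun)) θ v ≤
        C * closENorm (interpENorm S₀.toFun S₁.toFun θ) (enInter N₀.toFun N₁.toFun) v)) ∧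
    ((IsC0SeqStructure S₀ ∨ IsC0SeqStructure S₁) →
      ∃ C : ℝ≥0∞, C ≠ ∞ ∧ ∀ v : E,
        (interpENorm S₀.toFun S₁.toFun θ v ≤
          C * interpENorm
            (seqClosENorm S₀.toFun N₀.toFun (enInter N₀.toFun N₁.toFun))
            (seqClosENorm S₁.toFun N₁.toFun (enInter N₀.toFun N₁.toFun)) θ v) ∧
        (interpENorm
            (seqClosENorm S₀.toFun N₀.toFun (enInter N₀.toFun N₁.toFun))
            (seqClosENorm S₁.toFun N₁.toFun (enInter N₀.toFun N₁.toFun)) θ v ≤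
          C * interpENorm S₀.toFun S₁.toFun θ v)) := by
  have hp : 0 < Real.exp (-θ) := Real.exp_pos _
  have hp1 : Real.exp (-θ) < 1 := by rw [Real.exp_lt_one_iff]; linarith [hθ.1]
  have hq : 0 < Real.exp (1 - θ) := Real.exp_pos _
  have hq1 : (Real.exp (1 - θ))⁻¹ < 1 := by
    rw [← Real.exp_neg, Real.exp_lt_one_iff]; linarith [hθ.2]
  obtain ⟨C, hC1, hCt, hC⟩ := ISS.part1b hcomp hl₀ hl₁ hp hp1 hq hq1
  have hC0 : C ≠ 0 := (lt_of_lt_of_le one_pos hC1).ne'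
  refine ⟨⟨C, hCt, fun v => ⟨?_, ?_⟩⟩, fun hc => ⟨C, hCt, fun v => ⟨?_, ?_⟩⟩⟩
  · exact (ISS.part1a hl₀ hl₁ hp hq v).trans (le_mul_of_one_le_left zero_le hC1)
  · by_cases hm : memClosIn (interpENorm S₀.toFun S₁.toFun θ) (enInter N₀.toFun N₁.toFun) v
    · rw [closENorm, if_pos hm]
      exact hC v hm
    · rw [closENorm, if_neg hm, ENNReal.mul_top hC0]
      exact le_top
  · refine le_trans ?_ (le_mul_of_one_le_left zero_le hC1)
    exact iInf₂_mono fun x _ => max_le_max (ISS.seqClos_ge S₀ _ _ x) (ISS.seqClos_ge S₁ _ _ x)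
  · by_cases hv : interpENorm S₀.toFun S₁.toFun θ v = ∞
    · rw [hv, ENNReal.mul_top hC0]
      exact le_top
    · exact hC v (ISS.part2 hl₀ hl₁ hp hp1 hq hq1 hc hv)
end

section
/- Let (𝒳₀,𝒳₁) be a compatible couple of sequentially structured Banach spaces and let θ ∈ (0,1). For x ∈ X₀+X₁ define ‖x‖^{(c)}_{(𝒳₀,𝒳₁)_θ} := inf{ max_{j=0,1} ‖f̂_j‖_{𝔖_j} : f ∈ ℋ_π(S̄;X₀+X₁), f(θ) = x }, where the infimum is over analytic 2πi-periodic functions on the strip which extend continuously to the closed strip S̄. Then ‖x‖_{(𝒳₀,𝒳₁)_θ} ≤ ‖x‖^{(c)}_{(𝒳₀,𝒳₁)_θ} for all x ∈ X₀+X₁, and if 𝔖₀ and 𝔖₁ are ℓ∞-sequence structures, then also ‖x‖^{(c)}_{(𝒳₀,𝒳₁)_θ} ≲_θ ‖x‖_{(𝒳₀,𝒳₁)_θ} for all x ∈ X₀ ∩ X₁, with a constant depending only on θ. -/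
open scoped ENNReal NNReal
open Filter Topology

universe u v

lemma aux_exp_int (k : ℤ) (r : ℝ) : Real.exp ((k : ℝ) * r) = Real.exp r ^ k := by
  rw [mul_comm, Real.exp_mul, Real.rpow_intCast]

lemma aux_fc_bound {E : Type*} [NormedAddCommGroup E] [NormedSpace ℂ E]
    (f : ℂ → E) (s : ℝ) : ∃ M : ℝ, 0 ≤ M ∧ ∀ k : ℤ, ‖fourierCoef f s k‖ ≤ M := by
  refine ⟨‖(2 * (Real.pi : ℂ))⁻¹‖ * ∫ t in (-Real.pi)..Real.pi,
    ‖f ((s : ℂ) + (t : ℂ) * Complex.I)‖, ?_, ?_⟩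
  · refine mul_nonneg (norm_nonneg _) ?_
    exact intervalIntegral.integral_nonneg (by linarith [Real.pi_pos]) (fun _ _ => norm_nonneg _)
  · intro k
    unfold fourierCoef
    rw [norm_smul]
    refine mul_le_mul_of_nonneg_left ?_ (norm_nonneg _)
    refine (intervalIntegral.norm_integral_le_integral_norm (by linarith [Real.pi_pos])).trans
      (le_of_eq ?_)
    congr 1
    funext t
    rw [norm_smul]
    have : -(k : ℂ) * Complex.I * (t : ℂ) = ((-(k : ℝ) * t : ℝ) : ℂ) * Complex.I := by
      push_cast; ring
    rw [this, Complex.norm_exp_ofReal_mul_I, one_mul]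

lemma aux_exp_period (k : ℤ) (z : ℂ) :
    Complex.exp (-(k : ℂ) * (z + 2 * (Real.pi : ℂ) * Complex.I)) = Complex.exp (-(k : ℂ) * z) := by
  have : -(k : ℂ) * (z + 2 * (Real.pi : ℂ) * Complex.I)
      = -(k : ℂ) * z + ((-k : ℤ) : ℂ) * (2 * (Real.pi : ℂ) * Complex.I) := by
    push_cast; ring
  rw [this, Complex.exp_add, Complex.exp_int_mul_two_pi_mul_I, mul_one]

lemma aux_fc_shift {E : Type*} [NormedAddCommGroup E] [NormedSpace ℂ E] [CompleteSpace E]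
    (f : ℂ → E) (hc : ContinuousOn f closedStrip)
    (hd : ∀ z ∈ openStrip, DifferentiableAt ℂ f z)
    (hp : ∀ z ∈ closedStrip, f (z + 2 * (Real.pi : ℂ) * Complex.I) = f z)
    (s : ℝ) (hs0 : 0 ≤ s) (hs1 : s ≤ 1) (k : ℤ) :
    fourierCoef f s k = (Real.exp s ^ k : ℝ) • fourierCoef f 0 k := by
  have hpi := Real.pi_pos
  set G : ℂ → E := fun z => Complex.exp (-(k : ℂ) * z) • f z with hG
  have key := Complex.integral_boundary_rect_eq_zero_of_continuousOn_of_differentiableOn G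
    (-(Real.pi : ℂ) * Complex.I) ((s : ℂ) + (Real.pi : ℂ) * Complex.I) ?_ ?_
  rotate_left
  · refine ContinuousOn.smul (by fun_prop) (hc.mono ?_)
    intro z hz
    rw [Complex.mem_reProdIm] at hz
    have h1 := hz.1
    simp [Set.uIcc_of_le hs0] at h1
    exact ⟨h1.1, h1.2.trans hs1⟩
  · intro z hz
    rw [Complex.mem_reProdIm] at hz
    have h1 := hz.1
    simp [hs0] at h1
    have hz' : z ∈ openStrip := ⟨h1.1, h1.2.trans_le hs1⟩
    refine DifferentiableAt.differentiableWithinAt ?_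
    exact DifferentiableAt.smul (by fun_prop) (hd z hz')
  have hhor : (∫ x in (0:ℝ)..s, G (x + (-Real.pi : ℝ) * Complex.I))
      = ∫ x in (0:ℝ)..s, G (x + (Real.pi : ℝ) * Complex.I) := by
    refine intervalIntegral.integral_congr ?_
    intro x hx
    rw [Set.uIcc_of_le hs0] at hx
    have e : (x : ℂ) + (Real.pi : ℝ) * Complex.I
        = (x + (-Real.pi : ℝ) * Complex.I) + 2 * (Real.pi : ℂ) * Complex.I := by
      push_cast; ring
    simp only [hG]
    rw [e, aux_exp_period, hp]
    exact ⟨by simpa using hx.1, by simpa using hx.2.trans hs1⟩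
  simp only [Complex.mul_re, Complex.neg_re, Complex.ofReal_re, Complex.I_re, Complex.neg_im,
    Complex.ofReal_im, Complex.I_im, Complex.mul_im, Complex.add_re, Complex.add_im, mul_zero,
    neg_zero, zero_mul, sub_zero, mul_one, add_zero, zero_add] at key
  rw [hhor] at key
  rw [sub_self, zero_add, ← smul_sub, smul_eq_zero, sub_eq_zero] at key
  replace key := key.resolve_left Complex.I_ne_zero
  have hv : ∀ r : ℝ, (∫ y in (-Real.pi)..Real.pi, G (r + y * Complex.I))
      = Complex.exp (-(k : ℂ) * r) • ∫ t in (-Real.pi)..Real.pi,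
        Complex.exp (-(k : ℂ) * Complex.I * (t : ℂ)) • f ((r : ℂ) + (t : ℂ) * Complex.I) := by
    intro r
    rw [← intervalIntegral.integral_smul]
    refine intervalIntegral.integral_congr ?_
    intro t _
    simp only [hG]
    rw [smul_smul, ← Complex.exp_add]
    congr 2
    ring
  rw [hv, hv] at key
  unfold fourierCoef
  have h2 : (Complex.exp ((k : ℂ) * s)) = ((Real.exp s ^ k : ℝ) : ℂ) := by
    rw [← aux_exp_int]; push_cast; rfl
  rw [← Complex.coe_smul, ← h2]
  have h3 := congrArg (fun w => Complex.exp ((k : ℂ) * s) • w) key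
  simp only [smul_smul, ← Complex.exp_add] at h3
  simp only [neg_mul, add_neg_cancel, Complex.exp_zero, one_smul, Complex.ofReal_zero, mul_zero,
    neg_zero, add_zero] at h3
  simp only [neg_mul, Complex.ofReal_zero]
  rw [h3, smul_comm]

lemma aux_summable_exp (c : ℝ) (hc : 0 < c) :
    Summable (fun k : ℤ => Real.exp (-c * |(k : ℝ)|)) := by
  have h : Summable (fun n : ℕ => Real.exp (-c * (n : ℝ))) := by
    have := summable_geometric_of_lt_one (Real.exp_pos (-c)).le (by simpa using hc)
    refine this.congr ?_
    intro n
    rw [← Real.exp_nat_mul, mul_comm]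
  refine Summable.of_nat_of_neg ?_ ?_ <;> simpa using h

lemma aux_scalar (g : ℝ → ℂ) (hg : Continuous g) (hper : Function.Periodic g (2 * Real.pi))
    (c : ℤ → ℂ) (hcdef : ∀ k, c k = (2 * (Real.pi : ℂ))⁻¹ • ∫ t in (-Real.pi)..Real.pi,
      Complex.exp (-(k : ℂ) * Complex.I * (t : ℂ)) • g t)
    (hs : Summable c) : HasSum c (g 0) := by
  have hpi := Real.pi_pos
  have : Fact (0 < 2 * Real.pi) := ⟨by positivity⟩
  let F : C(AddCircle (2 * Real.pi), ℂ) := ⟨hper.lift, continuous_quot_lift _ hg⟩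
  have hF : ∀ t : ℝ, F (t : AddCircle (2 * Real.pi)) = g t := fun t => rfl
  have hco : fourierCoeff F = c := by
    funext k
    rw [fourierCoeff_eq_intervalIntegral _ _ (-Real.pi), hcdef k]
    have e : -Real.pi + 2 * Real.pi = Real.pi := by ring
    rw [e, ← Complex.coe_smul]
    push_cast
    rw [one_div]
    congr 1
    refine intervalIntegral.integral_congr ?_
    intro t _
    simp only [hF, fourier_coe_apply]
    congr 2
    push_cast
    field_simp
  have := has_pointwise_sum_fourier_series_of_summable (f := F) (by rwa [hco]) ((0 : ℝ) : AddCircle (2 * Real.pi))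
  rw [hco, hF] at this
  simpa using this

lemma aux_line_cont {E : Type*} [NormedAddCommGroup E] [NormedSpace ℂ E]
    (f : ℂ → E) (hc : ContinuousOn f closedStrip) (s : ℝ) (hs0 : 0 ≤ s) (hs1 : s ≤ 1) :
    Continuous (fun t : ℝ => f ((s : ℂ) + (t : ℂ) * Complex.I)) := by
  refine hc.comp_continuous (by fun_prop) ?_
  intro t
  exact ⟨by simpa using hs0, by simpa using hs1⟩

lemma aux_part1 (θ : ℝ) (hθ : θ ∈ Set.Ioo (0 : ℝ) 1)
    {E : Type*} [NormedAddCommGroup E] [NormedSpace ℂ E] [CompleteSpace E]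
    (S₀ S₁ : (ℤ → E) → ℝ≥0∞) (v : E) :
    interpENorm S₀ S₁ θ v ≤ lowerCNorm S₀ S₁ θ v := by
  unfold lowerCNorm
  refine le_iInf fun f => le_iInf fun hc => le_iInf fun hd => le_iInf fun hp => le_iInf fun hv => ?_
  have hθ0 := hθ.1
  have hθ1 := hθ.2
  have e1 := fun k => aux_fc_shift f hc hd hp 1 zero_le_one le_rfl k
  have eθ := fun k => aux_fc_shift f hc hd hp θ hθ0.le hθ1.le k
  obtain ⟨M0, hM0, hb0⟩ := aux_fc_bound f 0
  obtain ⟨M1, hM1, hb1⟩ := aux_fc_bound f 1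
  set x : ℤ → E := fun k => fourierCoef f θ k with hx
  have hpos : ∀ r : ℝ, 0 < Real.exp r := Real.exp_pos
  have hbound : ∀ k : ℤ, ‖x k‖ ≤ (M0 + M1) * Real.exp (-(min θ (1 - θ)) * |(k : ℝ)|) := by
    intro k
    rcases le_total k 0 with hk | hk
    · have hk' : (k : ℝ) ≤ 0 := by exact_mod_cast hk
      have : ‖x k‖ ≤ M0 * Real.exp ((k : ℝ) * θ) := by
        simp only [hx]
        rw [eθ k, norm_smul, ← aux_exp_int, Real.norm_of_nonneg (hpos _).le, mul_comm]
        exact mul_le_mul_of_nonneg_right (hb0 k) (hpos _).le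
      refine this.trans (mul_le_mul (by linarith) ?_ (hpos _).le (by linarith))
      rw [Real.exp_le_exp, abs_of_nonpos hk']
      nlinarith [min_le_left θ (1 - θ)]
    · have hk' : 0 ≤ (k : ℝ) := by exact_mod_cast hk
      have : ‖x k‖ ≤ M1 * Real.exp (-(k : ℝ) * (1 - θ)) := by
        have e : x k = Real.exp (-(k : ℝ) * (1 - θ)) • fourierCoef f 1 k := by
          simp only [hx]
          rw [eθ k, e1 k, smul_smul, ← aux_exp_int, ← aux_exp_int, ← Real.exp_add]
          congr 2
          ring
        rw [e, norm_smul, Real.norm_of_nonneg (hpos _).le, mul_comm]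
        exact mul_le_mul_of_nonneg_right (hb1 k) (hpos _).le
      refine this.trans (mul_le_mul (by linarith) ?_ (hpos _).le (by linarith))
      rw [Real.exp_le_exp, abs_of_nonneg hk']
      nlinarith [min_le_right θ (1 - θ)]
  have hsum : Summable x :=
    Summable.of_norm_bounded ((aux_summable_exp _ (lt_min hθ0 (by linarith))).mul_left _) hbound
  have hcont := aux_line_cont f hc θ hθ0.le hθ1.le
  have hhas : HasSum x v := by
    have h := hsum.hasSum
    convert h using 1
    refine (SeparatingDual.eq_iff_forall_dual_eq (R := ℂ)).2 ?_
    intro φ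
    have h2 : HasSum (fun k => φ (x k)) (φ (∑' k, x k)) := φ.hasSum h
    have h3 := aux_scalar (fun t => φ (f ((θ : ℂ) + (t : ℂ) * Complex.I))) (φ.continuous.comp hcont)
      ?_ (fun k => φ (x k)) ?_ h2.summable
    · have h4 := h3.unique h2
      rw [← h4]
      simp [hv]
    · intro t
      have e : (θ : ℂ) + ((t + 2 * Real.pi : ℝ) : ℂ) * Complex.I
        = ((θ : ℂ) + (t : ℂ) * Complex.I) + 2 * (Real.pi : ℂ) * Complex.I := by push_cast; ring
      simp only []
      rw [e, hp]
      exact ⟨by simpa using hθ0.le, by simpa using hθ1.le⟩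
    · intro k
      simp only [hx, fourierCoef]
      rw [map_smul, ← ContinuousLinearMap.intervalIntegral_comp_comm]
      · simp only [map_smul]
      · refine Continuous.intervalIntegrable ?_ _ _
        exact Continuous.smul (by fun_prop) hcont
  refine iInf₂_le_of_le x hhas (le_of_eq ?_)
  congr 1
  · unfold wtSeq
    congr 1
    funext k
    simp only [hx]
    rw [eθ k, smul_smul, ← mul_zpow, ← Real.exp_add]
    simp
  · unfold wtSeq
    congr 1
    funext k
    simp only [hx]
    rw [eθ k, e1 k, smul_smul, ← mul_zpow, ← Real.exp_add]
    simp

section ENormLemmas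

variable {V : Type*} [AddCommGroup V] [Module ℂ V] {N : V → ℝ≥0∞}

lemma aux_zero (hN : IsBanachENorm ℂ N) : N 0 = 0 := by
  have := hN.2.2.1 0 (0 : V)
  simpa using this

lemma aux_smul (hN : IsBanachENorm ℂ N) (r : ℝ) (x : V) :
    N ((r : ℂ) • x) ≤ ENNReal.ofReal |r| * N x := by
  refine (hN.2.2.1 (r : ℂ) x).trans (le_of_eq ?_)
  congr 1
  rw [← Real.norm_eq_abs, ← Complex.norm_real, ofReal_norm]
  rfl

lemma aux_neg (hN : IsBanachENorm ℂ N) (x : V) : N (-x) ≤ N x := by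
  have := hN.2.2.1 (-1) x
  simpa using this

lemma aux_sum (hN : IsBanachENorm ℂ N) {ι : Type*} (s : Finset ι) (a : ι → V) :
    N (∑ i ∈ s, a i) ≤ ∑ i ∈ s, N (a i) := by
  classical
  induction s using Finset.induction_on with
  | empty => simp [aux_zero hN]
  | insert i s hi ih =>
    rw [Finset.sum_insert hi, Finset.sum_insert hi]
    exact (hN.2.1 _ _).trans (by gcongr)

end ENormLemmas

section Part2

variable {E : Type*} [NormedAddCommGroup E] [NormedSpace ℂ E]

lemma aux_smul_seq {X : BanachENorm ℂ E} (S : SeqStructure ℂ E X) (r : ℝ) (x : ℤ → E) :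
    S.toFun (fun k => r • x k) ≤ ENNReal.ofReal |r| * S.toFun x := by
  have := aux_smul S.isBanachENorm r x
  refine le_trans (le_of_eq ?_) this
  congr 1

lemma aux_tsum {X : BanachENorm ℂ E} (S : SeqStructure ℂ E X)
    (hX : ∀ w, (‖w‖₊ : ℝ≥0∞) ≤ X.toFun w) (a : ℕ → ℤ → E) (b : ℕ → ℝ≥0∞)
    (hb : ∑' m, b m ≠ ∞) (ha : ∀ m, S.toFun (a m) ≤ b m) (y : ℤ → E)
    (hy : ∀ k, HasSum (fun m => a m k) (y k)) : S.toFun y ≤ ∑' m, b m := by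
  have hS := S.isBanachENorm
  set P : ℕ → ℤ → E := fun n => ∑ m ∈ Finset.range n, a m with hP
  have hPb : ∀ n, S.toFun (P n) ≤ ∑' m, b m := fun n =>
    (aux_sum hS _ _).trans ((Finset.sum_le_sum fun i _ => ha i).trans (ENNReal.sum_le_tsum _))
  have hdiff : ∀ m n, m ≤ n → S.toFun (P n - P m) ≤ ∑' k, b (k + m) := by
    intro m n hmn
    simp only [hP]
    rw [← Finset.sum_Ico_eq_sub _ hmn, Finset.sum_Ico_eq_sum_range]
    refine (aux_sum hS _ _).trans ((Finset.sum_le_sum fun i _ => ha _).trans ?_)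
    refine le_trans (le_of_eq ?_) (ENNReal.sum_le_tsum (Finset.range (n - m)))
    exact Finset.sum_congr rfl fun i _ => by rw [add_comm]
  have htail := ENNReal.tendsto_sum_nat_add b hb
  obtain ⟨z, -, hz⟩ := hS.2.2.2 P (fun n => ((hPb n).trans_lt hb.lt_top).ne) (by
    intro ε hε
    obtain ⟨n₀, hn₀⟩ := eventually_atTop.1 (htail.eventually_lt_const hε)
    refine ⟨n₀, fun m hm n hn => ?_⟩
    rcases le_total m n with h | h
    · have := aux_neg hS (P n - P m)
      rw [neg_sub] at this
      exact (this.trans (hdiff m n h)).trans_lt (hn₀ m hm)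
    · exact (hdiff n m h).trans_lt (hn₀ n hn))
  have hzy : z = y := by
    funext k
    have h1 : Tendsto (fun n => P n k) atTop (𝓝 (y k)) := by
      have := (hy k).tendsto_sum_nat
      refine this.congr fun n => ?_
      simp [hP]
    have h2 : Tendsto (fun n => P n k) atTop (𝓝 (z k)) := by
      rw [tendsto_iff_edist_tendsto_0]
      refine tendsto_of_tendsto_of_tendsto_of_le_of_le tendsto_const_nhds hz
        (fun _ => bot_le) (fun n => ?_)
      rw [edist_eq_enorm_sub]
      exact (hX (P n k - z k)).trans (S.coord (P n - z) k)
    exact tendsto_nhds_unique h2 h1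
  subst hzy
  have h3 : Tendsto (fun n => ∑' m, b m + S.toFun (P n - z)) atTop (𝓝 (∑' m, b m + 0)) :=
    tendsto_const_nhds.add hz
  rw [add_zero] at h3
  refine ge_of_tendsto' h3 fun n => ?_
  have e : z = P n + (z - P n) := by abel
  calc S.toFun z = S.toFun (P n + (z - P n)) := by rw [← e]
    _ ≤ S.toFun (P n) + S.toFun (z - P n) := hS.2.1 _ _
    _ ≤ _ := by
      gcongr
      · exact hPb n
      · have := aux_neg hS (P n - z)
        rwa [neg_sub] at this

lemma aux_geom {X : BanachENorm ℂ E} (S : SeqStructure ℂ E X)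
    (hX : ∀ w, (‖w‖₊ : ℝ≥0∞) ≤ X.toFun w) (y z : ℤ → E) (ρ : ℝ) (hρ0 : 0 < ρ) (hρ1 : ρ < 1)
    (d r : ℤ) (hz : ∀ k, HasSum (fun m : ℕ => ρ ^ m • y (k + (d * m + r))) (z k)) :
    S.toFun z ≤ ENNReal.ofReal (1 - ρ)⁻¹ * S.toFun y := by
  have hpos : 0 < (1 - ρ)⁻¹ := inv_pos.2 (by linarith)
  by_cases hy : S.toFun y = ∞
  · rw [hy, ENNReal.mul_top (by simpa using hρ1)]
    exact le_top
  have hts : ∑' m : ℕ, ENNReal.ofReal (ρ ^ m) * S.toFun y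
      = ENNReal.ofReal (1 - ρ)⁻¹ * S.toFun y := by
    rw [ENNReal.tsum_mul_right, ← ENNReal.ofReal_tsum_of_nonneg (fun m => by positivity)
      (summable_geometric_of_lt_one hρ0.le hρ1), tsum_geometric_of_lt_one hρ0.le hρ1]
  rw [← hts]
  refine aux_tsum S hX (fun m k => ρ ^ m • y (k + (d * m + r))) _ ?_ ?_ z hz
  · rw [hts]
    exact ENNReal.mul_ne_top ENNReal.ofReal_ne_top hy
  · intro m
    have := aux_smul_seq S (ρ ^ m) (fun k => y (k + (d * m + r)))
    rwa [S.shift y, abs_of_pos (by positivity)] at this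

lemma aux_vpart {X : BanachENorm ℂ E} (S : SeqStructure ℂ E X) (s : Finset ℤ) (g q : ℤ → ℝ)
    (hg : ∀ k, k ∉ s → g k = 0) (hq : Summable q) (δ : ℝ) (hgq : ∀ k, |g k| ≤ δ * q k) (v : E) :
    S.toFun (fun k => g k • v) ≤ ENNReal.ofReal (δ * ∑' k, q k) * X.toFun v := by
  have e : (fun k => g k • v) = ∑ i ∈ s, ((g i : ℝ) : ℂ) • (fun k => if k = i then v else 0) := by
    funext k
    simp only [Finset.sum_apply, Pi.smul_apply, Complex.coe_smul, smul_ite, smul_zero]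
    rw [Finset.sum_ite_eq]
    split_ifs with h
    · rfl
    · rw [hg k h, zero_smul]
  rw [e]
  refine (aux_sum S.isBanachENorm _ _).trans ?_
  calc ∑ i ∈ s, S.toFun (((g i : ℝ) : ℂ) • (fun k => if k = i then v else 0))
      ≤ ∑ i ∈ s, ENNReal.ofReal |g i| * X.toFun v := by
        refine Finset.sum_le_sum fun i _ => ?_
        refine (aux_smul S.isBanachENorm _ _).trans ?_
        rw [S.single]
    _ = ENNReal.ofReal (∑ i ∈ s, |g i|) * X.toFun v := by
        rw [← Finset.sum_mul, ENNReal.ofReal_sum_of_nonneg (fun _ _ => abs_nonneg _)]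
    _ ≤ _ := by
        gcongr
        rw [← tsum_mul_left]
        refine (Finset.sum_le_sum fun i _ => hgq i).trans ?_
        exact (hq.mul_left δ).sum_le_tsum _ (fun i _ => (abs_nonneg _).trans (hgq i))

/-- The Cesaro weights. -/
noncomputable def auxCC (n : ℕ) (k : ℤ) : ℝ := ((n + 1 - k.natAbs : ℕ) : ℝ) / (n + 1)

lemma aux_cesaro (n : ℕ) (x : ℤ → E) (k : ℤ) : cesaro ℂ n x k = auxCC n k • x k := by
  unfold cesaro auxCC
  rw [← Finset.sum_filter, Finset.sum_const]
  have : (Finset.range (n + 1)).filter (fun m : ℕ => |k| ≤ (m : ℤ))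
      = Finset.Ico k.natAbs (n + 1) := by
    ext m
    simp only [Finset.mem_filter, Finset.mem_range, Finset.mem_Ico]
    rw [Int.abs_eq_natAbs]
    omega
  rw [this, Nat.card_Ico, ← Nat.cast_smul_eq_nsmul ℂ, smul_smul, ← Complex.coe_smul]
  congr 1
  push_cast
  rw [div_eq_inv_mul]

lemma aux_cc_zero (n : ℕ) : auxCC n 0 = 1 := by
  have h : (n : ℝ) + 1 ≠ 0 := by positivity
  unfold auxCC
  simp [h]

lemma aux_cc_out (n : ℕ) (k : ℤ) (h : (n : ℤ) + 1 ≤ |k|) : auxCC n k = 0 := by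
  unfold auxCC
  rw [Int.abs_eq_natAbs] at h
  have : n + 1 - k.natAbs = 0 := by omega
  simp [this]

lemma aux_cc_diff (n : ℕ) (k : ℤ) : |auxCC n (k - 1) - auxCC n k| ≤ 1 / ((n : ℝ) + 1) := by
  unfold auxCC
  rw [← sub_div, abs_div, abs_of_pos (by positivity : (0 : ℝ) < (n : ℝ) + 1)]
  gcongr
  have h1 : n + 1 - (k - 1).natAbs ≤ n + 1 - k.natAbs + 1 := by omega
  have h2 : n + 1 - k.natAbs ≤ n + 1 - (k - 1).natAbs + 1 := by omega
  have h1' : ((n + 1 - (k - 1).natAbs : ℕ) : ℝ) ≤ ((n + 1 - k.natAbs : ℕ) : ℝ) + 1 := by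
    exact_mod_cast h1
  have h2' : ((n + 1 - k.natAbs : ℕ) : ℝ) ≤ ((n + 1 - (k - 1).natAbs : ℕ) : ℝ) + 1 := by
    exact_mod_cast h2
  rw [abs_le]
  constructor <;> linarith

lemma aux_comm {X : BanachENorm ℂ E} (S : SeqStructure ℂ E X) (hS : IsLinftySeqStructure S)
    (w : ℝ) (hw : 0 < w) (n : ℕ) (p : ℤ → E) :
    S.toFun (fun k => w ^ k • (auxCC n (k - 1) • p (k - 1) - auxCC n k • p k))
      ≤ ENNReal.ofReal (w + 1) * S.toFun (fun k => w ^ k • p k) := by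
  set P : ℤ → E := fun k => w ^ k • p k with hP
  have e : (fun k => w ^ k • (auxCC n (k - 1) • p (k - 1) - auxCC n k • p k))
      = (fun k => w • cesaro ℂ n P (k + (-1))) + -(cesaro ℂ n P) := by
    funext k
    simp only [Pi.add_apply, Pi.neg_apply, aux_cesaro, hP]
    rw [smul_sub, sub_eq_add_neg]
    congr 1
    · rw [← sub_eq_add_neg, smul_comm w, smul_smul w, smul_comm (w ^ k)]
      congr 2
      rw [← zpow_one_add₀ hw.ne']
      congr 1
      ring
    · rw [smul_comm]
  rw [e]
  refine (S.isBanachENorm.2.1 _ _).trans ?_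
  rw [ENNReal.ofReal_add hw.le zero_le_one, add_mul, ENNReal.ofReal_one, one_mul]
  gcongr
  · refine (aux_smul_seq S w (fun k => cesaro ℂ n P (k + (-1)))).trans ?_
    rw [S.shift (cesaro ℂ n P), abs_of_pos hw]
    gcongr
    exact hS n P
  · exact (aux_neg S.isBanachENorm _).trans (hS n P)

lemma aux_orth (k m : ℤ) : (∫ t in (-Real.pi)..Real.pi,
      Complex.exp (((m - k : ℤ) : ℂ) * Complex.I * (t : ℂ)))
      = if k = m then 2 * (Real.pi : ℂ) else 0 := by
  split_ifs with h
  · subst h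
    simp
    ring
  · have h0 : (((m - k : ℤ) : ℂ) * Complex.I) ≠ 0 := by
      refine mul_ne_zero ?_ Complex.I_ne_zero
      exact_mod_cast sub_ne_zero.2 (Ne.symm h)
    rw [integral_exp_mul_complex h0]
    have : Complex.exp (((m - k : ℤ) : ℂ) * Complex.I * (Real.pi : ℂ))
        = Complex.exp (((m - k : ℤ) : ℂ) * Complex.I * ((-Real.pi : ℝ) : ℂ)) := by
      rw [Complex.exp_eq_exp_iff_exists_int]
      refine ⟨m - k, ?_⟩
      push_cast
      ring
    rw [this, sub_self, zero_div]

lemma aux_fc_poly [CompleteSpace E] (s : Finset ℤ) (a : ℤ → E) (θ r : ℝ) (k : ℤ) :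
    fourierCoef (fun z => ∑ m ∈ s, Complex.exp ((m : ℂ) * (z - θ)) • a m) r k
      = if k ∈ s then (Real.exp (r - θ) ^ k : ℝ) • a k else 0 := by
  unfold fourierCoef
  simp only [Finset.smul_sum, smul_smul]
  rw [intervalIntegral.integral_finsetSum]
  · have : ∀ m ∈ s, (∫ t in (-Real.pi)..Real.pi,
        (Complex.exp (-(k : ℂ) * Complex.I * (t : ℂ)) *
          Complex.exp ((m : ℂ) * ((r : ℂ) + (t : ℂ) * Complex.I - θ))) • a m)
        = if k = m then (2 * (Real.pi : ℂ)) • ((Real.exp (r - θ) ^ k : ℝ) • a k) else 0 := by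
      intro m _
      rw [intervalIntegral.integral_smul_const]
      have e : ∀ t : ℝ, Complex.exp (-(k : ℂ) * Complex.I * (t : ℂ)) *
          Complex.exp ((m : ℂ) * ((r : ℂ) + (t : ℂ) * Complex.I - θ))
          = Complex.exp ((m : ℂ) * (r - θ)) *
            Complex.exp (((m - k : ℤ) : ℂ) * Complex.I * (t : ℂ)) := by
        intro t
        rw [← Complex.exp_add, ← Complex.exp_add]
        congr 1
        push_cast
        ring
      simp only [e]
      rw [intervalIntegral.integral_const_mul, aux_orth]
      split_ifs with h
      · subst h
        rw [mul_comm, mul_smul, ← Complex.coe_smul, ← aux_exp_int]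
        push_cast
        rfl
      · simp
    rw [Finset.sum_congr rfl this, Finset.sum_ite_eq]
    split_ifs with h
    · rw [smul_smul, inv_mul_cancel₀, one_smul]
      simp
    · simp
  · intro m _
    exact Continuous.intervalIntegrable (by fun_prop) _ _

end Part2

section Part2Main

variable {E : Type*} [NormedAddCommGroup E] [NormedSpace ℂ E]

lemma aux_g0 (θ : ℝ) (n : ℕ) (k : ℤ) :
    |Real.exp (-θ) ^ k * ((if k = 0 then 1 else 0) + (if 0 ≤ k - 1 then auxCC n (k - 1) else 0)
      - (if 0 ≤ k then auxCC n k else 0))|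
      ≤ (1 / ((n : ℝ) + 1)) * Real.exp (-θ * |(k : ℝ)|) := by
  have hn : (0 : ℝ) < 1 / ((n : ℝ) + 1) := by positivity
  rcases lt_trichotomy k 0 with h | h | h
  · rw [if_neg h.ne, if_neg (by omega), if_neg (by omega)]
    simp only [add_zero, sub_zero, mul_zero, abs_zero]
    positivity
  · subst h
    simp [aux_cc_zero]
    positivity
  · rw [if_neg h.ne', if_pos (by omega), if_pos h.le, zero_add, abs_mul,
      abs_of_pos (zpow_pos (Real.exp_pos _) _), ← aux_exp_int, mul_comm]
    have hk : (0 : ℝ) < (k : ℝ) := by exact_mod_cast h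
    rw [abs_of_pos hk, mul_comm (k : ℝ)]
    exact mul_le_mul_of_nonneg_right (aux_cc_diff n k) (Real.exp_pos _).le

lemma aux_g1 (θ : ℝ) (n : ℕ) (k : ℤ) :
    |Real.exp (1 - θ) ^ k * ((if k = 0 then 1 else 0) - (if k - 1 < 0 then auxCC n (k - 1) else 0)
      + (if k < 0 then auxCC n k else 0))|
      ≤ (1 / ((n : ℝ) + 1)) * Real.exp (-(1 - θ) * |(k : ℝ)|) := by
  have hn : (0 : ℝ) < 1 / ((n : ℝ) + 1) := by positivity
  rcases lt_trichotomy k 0 with h | h | h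
  · rw [if_neg h.ne, if_pos (by omega), if_pos h, zero_sub, abs_mul,
      abs_of_pos (zpow_pos (Real.exp_pos _) _), ← aux_exp_int, mul_comm]
    have hk : (k : ℝ) < 0 := by exact_mod_cast h
    rw [abs_of_neg hk]
    have e : -(1 - θ) * -(k : ℝ) = (k : ℝ) * (1 - θ) := by ring
    rw [e]
    refine mul_le_mul_of_nonneg_right ?_ (Real.exp_pos _).le
    rw [neg_add_eq_sub, abs_sub_comm]
    exact aux_cc_diff n k
  · subst h
    have := aux_cc_diff n 0
    rw [aux_cc_zero, abs_sub_comm] at this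
    simpa using this
  · rw [if_neg h.ne', if_neg (by omega), if_neg (by omega)]
    simp only [add_zero, sub_zero, mul_zero, abs_zero]
    positivity

lemma aux_main [CompleteSpace E] (θ : ℝ) (hθ : θ ∈ Set.Ioo (0 : ℝ) 1)
    {N₀ N₁ : BanachENorm ℂ E}
    (hsum : ∀ v : E, enSum N₀.toFun N₁.toFun v = (‖v‖₊ : ℝ≥0∞))
    (S₀ : SeqStructure ℂ E N₀) (S₁ : SeqStructure ℂ E N₁)
    (h₀ : IsLinftySeqStructure S₀) (h₁ : IsLinftySeqStructure S₁)
    (v : E) (x : ℤ → E) (hx : HasSum x v) (n : ℕ) :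
    lowerCNorm S₀.toFun S₁.toFun θ v ≤ max
      (ENNReal.ofReal ((1 / ((n : ℝ) + 1)) * ∑' k : ℤ, Real.exp (-θ * |(k : ℝ)|)) * N₀.toFun v
        + ENNReal.ofReal (Real.exp (-θ) + 1) * (ENNReal.ofReal (1 - Real.exp (-θ))⁻¹
          * wtSeq (Real.exp (-θ)) S₀.toFun x))
      (ENNReal.ofReal ((1 / ((n : ℝ) + 1)) * ∑' k : ℤ, Real.exp (-(1 - θ) * |(k : ℝ)|))
          * N₁.toFun v
        + ENNReal.ofReal (Real.exp (1 - θ) + 1) * (ENNReal.ofReal (Real.exp (1 - θ))⁻¹ *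
          (ENNReal.ofReal (1 - (Real.exp (1 - θ))⁻¹)⁻¹
          * wtSeq (Real.exp (1 - θ)) S₁.toFun x))) := by
  have hθ0 := hθ.1
  have hθ1 := hθ.2
  have hX0 : ∀ w, (‖w‖₊ : ℝ≥0∞) ≤ N₀.toFun w := by
    intro w
    rw [← hsum w]
    refine (iInf_le _ w).trans ?_
    rw [sub_self, aux_zero N₁.isBanachENorm, add_zero]
  have hX1 : ∀ w, (‖w‖₊ : ℝ≥0∞) ≤ N₁.toFun w := by
    intro w
    rw [← hsum w]
    refine (iInf_le _ 0).trans ?_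
    rw [sub_zero, aux_zero N₀.isBanachENorm, zero_add]
  -- the partial sums
  set u : ℤ → E := fun k => ∑' m : ℕ, x (k + (-1 * (m : ℤ) + 0)) with hu
  set t : ℤ → E := fun k => ∑' m : ℕ, x (k + (1 * (m : ℤ) + 1)) with ht
  have hus : ∀ k, HasSum (fun m : ℕ => x (k + (-1 * (m : ℤ) + 0))) (u k) := fun k =>
    (hx.summable.comp_injective (i := fun m : ℕ => k + (-1 * (m : ℤ) + 0))
      (fun a b h => by simp at h; exact h)).hasSum
  have hts : ∀ k, HasSum (fun m : ℕ => x (k + (1 * (m : ℤ) + 1))) (t k) := fun k =>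
    (hx.summable.comp_injective (i := fun m : ℕ => k + (1 * (m : ℤ) + 1))
      (fun a b h => by simp at h; exact h)).hasSum
  have hut : ∀ k, t k + u k = v := by
    intro k
    have e1 : HasSum (fun j : ℤ => x (k + 1 + j)) v := by
      have := (Equiv.addLeft (k + 1)).hasSum_iff (f := x) (a := v)
      exact this.2 hx
    refine HasSum.unique (HasSum.of_nat_of_neg_add_one (f := fun j : ℤ => x (k + 1 + j)) ?_ ?_) e1
    · convert hts k using 3
      ring
    · convert hus k using 3
      ring
  set h : ℤ → E := fun k => (if 0 ≤ k then v else 0) - u k with hh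
  have hh' : ∀ k, h k = t k - (if k < 0 then v else 0) := by
    intro k
    simp only [hh]
    by_cases hk : 0 ≤ k
    · rw [if_pos hk, if_neg (by omega), ← hut k]; abel
    · rw [if_neg hk, if_pos (by omega), ← hut k]; abel
  set a : ℤ → E := fun k => (if k = 0 then v else 0)
    + (auxCC n (k - 1) • h (k - 1) - auxCC n k • h k) with ha
  set s : Finset ℤ := Finset.Icc (-((n : ℤ) + 1)) (n + 1) with hs
  have hout : ∀ k, k ∉ s → k ≠ 0 ∧ auxCC n (k - 1) = 0 ∧ auxCC n k = 0 := by
    intro k hk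
    rw [hs, Finset.mem_Icc] at hk
    refine ⟨by omega, aux_cc_out _ _ ?_, aux_cc_out _ _ ?_⟩ <;> rw [Int.abs_eq_natAbs] <;> omega
  have has : ∀ k, k ∉ s → a k = 0 := by
    intro k hk
    obtain ⟨q1, q2, q3⟩ := hout k hk
    simp only [ha]
    rw [if_neg q1, q2, q3]
    simp
  have hasum : ∑ k ∈ s, a k = v := by
    simp only [ha]
    rw [Finset.sum_add_distrib, Finset.sum_sub_distrib, Finset.sum_ite_eq']
    have c1 : ∑ k ∈ s, auxCC n k • h k = ∑' k, auxCC n k • h k :=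
      (tsum_eq_sum (fun k hk => by rw [(hout k hk).2.2, zero_smul])).symm
    have c2 : ∑ k ∈ s, auxCC n (k - 1) • h (k - 1) = ∑' k, auxCC n (k - 1) • h (k - 1) :=
      (tsum_eq_sum (fun k hk => by rw [(hout k hk).2.1, zero_smul])).symm
    have c3 : ∑' k, auxCC n (k - 1) • h (k - 1) = ∑' k, auxCC n k • h k :=
      (Equiv.subRight (1 : ℤ)).tsum_eq (fun k => auxCC n k • h k)
    rw [c1, c2, c3, sub_self, add_zero, if_pos]
    rw [hs, Finset.mem_Icc]
    omega
  set f : ℂ → E := fun z => ∑ m ∈ s, Complex.exp ((m : ℂ) * (z - θ)) • a m with hf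
  have hfd : Differentiable ℂ f := by
    simp only [hf]
    fun_prop
  have hfc : ∀ (r : ℝ) (k : ℤ), fourierCoef f r k = Real.exp (r - θ) ^ k • a k := by
    intro r k
    rw [hf, aux_fc_poly]
    split_ifs with hk
    · rfl
    · rw [has k hk, smul_zero]
  unfold lowerCNorm
  refine iInf_le_of_le f (iInf_le_of_le hfd.continuous.continuousOn
    (iInf_le_of_le (fun z _ => hfd z) (iInf_le_of_le ?_ (iInf_le_of_le ?_ ?_))))
  · intro z _
    simp only [hf]
    refine Finset.sum_congr rfl fun m _ => ?_
    have := aux_exp_period (-m) (z - θ)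
    push_cast at this
    rw [neg_neg] at this
    rw [← this]
    congr 3
    ring
  · simp only [hf, sub_self, mul_zero, Complex.exp_zero, one_smul]
    exact hasum
  refine max_le_max ?_ ?_
  · have e : (fun k => fourierCoef f 0 k)
        = (fun k => (Real.exp (-θ) ^ k * ((if k = 0 then 1 else 0)
            + (if 0 ≤ k - 1 then auxCC n (k - 1) else 0)
            - (if 0 ≤ k then auxCC n k else 0))) • v)
          + (fun k => Real.exp (-θ) ^ k •
            (auxCC n (k - 1) • (-u) (k - 1) - auxCC n k • (-u) k)) := by
      funext k
      rw [hfc, zero_sub]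
      simp only [ha, hh, Pi.add_apply, Pi.neg_apply]
      rw [mul_smul, ← smul_add]
      congr 1
      simp only [sub_smul, add_smul, smul_sub, smul_ite, ite_smul, smul_zero, zero_smul, one_smul,
        smul_neg]
      abel
    rw [e]
    refine (S₀.isBanachENorm.2.1 _ _).trans ?_
    gcongr
    · refine aux_vpart S₀ s _ _ ?_ (aux_summable_exp θ hθ0) _ (aux_g0 θ n) v
      intro k hk
      obtain ⟨q1, q2, q3⟩ := hout k hk
      rw [if_neg q1, q2, q3]
      simp
    · refine (aux_comm S₀ h₀ _ (Real.exp_pos _) n (-u)).trans ?_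
      gcongr
      have e2 : (fun k => Real.exp (-θ) ^ k • (-u) k) = -(fun k => Real.exp (-θ) ^ k • u k) := by
        funext k
        simp
      rw [e2]
      refine (aux_neg S₀.isBanachENorm _).trans ?_
      refine aux_geom S₀ hX0 (fun k => Real.exp (-θ) ^ k • x k) _ _ (Real.exp_pos _)
        (by simpa using hθ0) (-1) 0 ?_
      intro k
      convert (hus k).const_smul (Real.exp (-θ) ^ k) using 2 with m
      rw [smul_smul, ← zpow_natCast, ← zpow_add₀ (Real.exp_pos _).ne']
      congr 2
      ring
  · have hw := Real.exp_pos (1 - θ)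
    have e : (fun k => fourierCoef f 1 k)
        = (fun k => (Real.exp (1 - θ) ^ k * ((if k = 0 then 1 else 0)
            - (if k - 1 < 0 then auxCC n (k - 1) else 0)
            + (if k < 0 then auxCC n k else 0))) • v)
          + (fun k => Real.exp (1 - θ) ^ k •
            (auxCC n (k - 1) • t (k - 1) - auxCC n k • t k)) := by
      funext k
      rw [hfc]
      simp only [ha, hh', Pi.add_apply]
      rw [mul_smul, ← smul_add]
      congr 1
      simp only [sub_smul, add_smul, smul_sub, smul_ite, ite_smul, smul_zero, zero_smul, one_smul]
      abel
    rw [e]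
    refine (S₁.isBanachENorm.2.1 _ _).trans ?_
    gcongr
    · refine aux_vpart S₁ s _ _ ?_ (aux_summable_exp (1 - θ) (by linarith)) _ (aux_g1 θ n) v
      intro k hk
      obtain ⟨q1, q2, q3⟩ := hout k hk
      rw [if_neg q1, q2, q3]
      simp
    · refine (aux_comm S₁ h₁ _ (Real.exp_pos _) n t).trans ?_
      gcongr
      have e2 : (fun k => Real.exp (1 - θ) ^ k • t k)
          = (fun k => (Real.exp (1 - θ))⁻¹ • (Real.exp (1 - θ) ^ (k + 1) • t k)) := by
        funext k
        rw [smul_smul, zpow_add_one₀ hw.ne', mul_comm, mul_assoc, mul_inv_cancel₀ hw.ne', mul_one]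
      rw [e2]
      refine (aux_smul_seq S₁ _ _).trans ?_
      rw [abs_of_pos (inv_pos.2 hw)]
      gcongr
      refine aux_geom S₁ hX1 (fun k => Real.exp (1 - θ) ^ k • x k) _ _ (inv_pos.2 hw)
        (inv_lt_one_of_one_lt₀ (by rw [Real.one_lt_exp_iff]; linarith)) 1 1 ?_
      intro k
      convert (hts k).const_smul (Real.exp (1 - θ) ^ (k + 1)) using 2 with m
      rw [smul_smul, ← zpow_natCast, ← zpow_neg_one, ← zpow_mul, ← zpow_add₀ hw.ne']
      congr 2
      ring

lemma aux_tend (K : ℝ) (A B : ℝ≥0∞) (hA : A ≠ ∞) :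
    Tendsto (fun n : ℕ => ENNReal.ofReal ((1 / ((n : ℝ) + 1)) * K) * A + B) atTop (𝓝 B) := by
  have h1 : Tendsto (fun n : ℕ => (1 / ((n : ℝ) + 1)) * K) atTop (𝓝 0) := by
    simpa using (tendsto_one_div_add_atTop_nhds_zero_nat (𝕜 := ℝ)).mul_const K
  have h2 := (ENNReal.tendsto_ofReal h1)
  rw [ENNReal.ofReal_zero] at h2
  have h3 := (ENNReal.Tendsto.mul_const h2 (Or.inr hA)).add_const B
  simpa using h3

end Part2Main

/-- lower complex formulation. With
`‖x‖^{(c)}_{(𝒳₀,𝒳₁)_θ} = inf {max_j ‖f̂_j‖_{𝔖_j} : f ∈ ℋ_π(S̄;X₀+X₁), f(θ) = x}`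
(the infimum over analytic `2πi`-periodic functions on the strip extending continuously to
the closed strip), one has `‖x‖_{(𝒳₀,𝒳₁)_θ} ≤ ‖x‖^{(c)}_{(𝒳₀,𝒳₁)_θ}` for all
`x ∈ X₀+X₁`, and, for `ℓ∞`-sequence structures,
`‖x‖^{(c)}_{(𝒳₀,𝒳₁)_θ} ≲_θ ‖x‖_{(𝒳₀,𝒳₁)_θ}` for all `x ∈ X₀ ∩ X₁`, with a constant
depending only on `θ`. -/
theorem statement15 (θ : ℝ) (hθ : θ ∈ Set.Ioo (0 : ℝ) 1) :
    (∀ (E : Type u) [NormedAddCommGroup E] [NormedSpace ℂ E] [CompleteSpace E],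
      ∀ N₀ N₁ : BanachENorm ℂ E,
        (∀ v : E, enSum N₀.toFun N₁.toFun v = (‖v‖₊ : ℝ≥0∞)) →
      ∀ (S₀ : SeqStructure ℂ E N₀) (S₁ : SeqStructure ℂ E N₁) (v : E),
        interpENorm S₀.toFun S₁.toFun θ v ≤ lowerCNorm S₀.toFun S₁.toFun θ v) ∧
    (∃ C : ℝ≥0∞, C ≠ ∞ ∧
      ∀ (E : Type u) [NormedAddCommGroup E] [NormedSpace ℂ E] [CompleteSpace E],
      ∀ N₀ N₁ : BanachENorm ℂ E,
        (∀ v : E, enSum N₀.toFun N₁.toFun v = (‖v‖₊ : ℝ≥0∞)) →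
      ∀ (S₀ : SeqStructure ℂ E N₀) (S₁ : SeqStructure ℂ E N₁),
        IsLinftySeqStructure S₀ → IsLinftySeqStructure S₁ →
      ∀ v : E, enInter N₀.toFun N₁.toFun v ≠ ∞ →
        lowerCNorm S₀.toFun S₁.toFun θ v ≤ C * interpENorm S₀.toFun S₁.toFun θ v) := by
  have hθ0 := hθ.1
  have hθ1 := hθ.2
  refine ⟨?_, ?_⟩
  · intro E _ _ _ N₀ N₁ _ S₀ S₁ v
    exact aux_part1 θ hθ S₀.toFun S₁.toFun v
  · set C₀ : ℝ≥0∞ := ENNReal.ofReal (Real.exp (-θ) + 1) * ENNReal.ofReal (1 - Real.exp (-θ))⁻¹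
      with hC0
    set C₁ : ℝ≥0∞ := ENNReal.ofReal (Real.exp (1 - θ) + 1) * (ENNReal.ofReal (Real.exp (1 - θ))⁻¹ *
      ENNReal.ofReal (1 - (Real.exp (1 - θ))⁻¹)⁻¹) with hC1
    have hCtop : C₀ + C₁ + 1 ≠ ∞ := by
      simp only [hC0, hC1]
      finiteness
    refine ⟨C₀ + C₁ + 1, hCtop, ?_⟩
    intro E _ _ _ N₀ N₁ hsum S₀ S₁ h₀ h₁ v hv
    have hv0 : N₀.toFun v ≠ ∞ := ne_top_of_le_ne_top hv (le_max_left _ _)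
    have hv1 : N₁.toFun v ≠ ∞ := ne_top_of_le_ne_top hv (le_max_right _ _)
    have hC : C₀ + C₁ + 1 ≠ 0 := by simp
    unfold interpENorm
    rw [ENNReal.mul_iInf_of_ne hC hCtop]
    refine le_iInf fun x => ?_
    rw [ENNReal.mul_iInf_of_ne hC hCtop]
    refine le_iInf fun hx => ?_
    have hmain := aux_main θ hθ hsum S₀ S₁ h₀ h₁ v x hx
    have hlim := ge_of_tendsto' (Tendsto.max (aux_tend _ _ _ hv0) (aux_tend _ _ _ hv1)) hmain
    refine hlim.trans (max_le ?_ ?_)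
    · rw [← mul_assoc, ← hC0]
      refine mul_le_mul' ?_ (le_max_left _ _)
      rw [add_assoc]
      exact le_self_add
    · rw [← mul_assoc, ← mul_assoc, mul_assoc (ENNReal.ofReal (Real.exp (1 - θ) + 1)), ← hC1]
      refine mul_le_mul' ?_ (le_max_right _ _)
      rw [add_comm C₀ C₁, add_assoc]
      exact le_self_add
end
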